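/- arXiv:1001.2577 — 9 statements merged into one kernel-verified Lean document; each statement's English description precedes it below -/
import Mathlib

section
/- Let h_1, ..., h_r be a sequence of homogeneous elements of A_+ and let d be the Krull dimension of A. Then the following three conditions are equivalent: (1) h_1, ..., h_r is a filter-regular homogeneous system of parameters for A; (2) h_1, ..., h_r is a filter-regular sequence, r ≤ d, and A/(h_1, ..., h_r) is a finite-dimensional k-vector space; (3) the extended sequence h_1, ..., h_r, 0 is a filter-regular sequence and r ≤ d. -/
/-- A sequence `h 0, ..., h (r-1)` of elements of a graded algebra is *filter-regular*
if for each `i` the annihilator of `h i` in `A/(h 0, ..., h (i-1))` has bounded degree,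
i.e. every homogeneous element of sufficiently large degree that multiplies `h i` into
the ideal generated by the previous elements already lies in that ideal. -/
def FilterRegular {k A : Type*} [Field k] [CommRing A] [Algebra k A]
    (𝒜 : ℕ → Submodule k A) {r : ℕ} (h : Fin r → A) : Prop :=
  ∀ i : Fin r, ∃ N : ℕ, ∀ n : ℕ, N ≤ n → ∀ x ∈ 𝒜 n,
    x * h i ∈ Ideal.span (h '' {j | j < i}) → x ∈ Ideal.span (h '' {j | j < i})

section IntegralDimension

variable {R S : Type*} [CommRing R] [CommRing S] [Algebra R S]

theorem ringKrullDim_le_of_isIntegral [Algebra.IsIntegral R S] :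
    ringKrullDim S ≤ ringKrullDim R :=
  Order.krullDim_le_of_strictMono (PrimeSpectrum.comap (algebraMap R S))
    fun _ _ hIJ ↦ Ideal.IsIntegral.comap_lt_comap hIJ

end IntegralDimension

section GradedQuotient

open DirectSum

variable {k A : Type*} [Field k] [CommRing A] [Algebra k A]

theorem exists_lifts_of_finite_quotient (I : Ideal A) [FiniteDimensional k (A ⧸ I)] :
    ∃ (m : ℕ) (t : Fin m → A), ∀ x : A, ∃ c : Fin m → k, x - ∑ i, c i • t i ∈ I := by
  obtain ⟨m, s, hs⟩ := Module.Finite.exists_fin (R := k) (M := A ⧸ I)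
  choose t ht using fun i ↦ Ideal.Quotient.mk_surjective (s i)
  refine ⟨m, t, fun x ↦ ?_⟩
  have hx : Ideal.Quotient.mk I x ∈ Submodule.span k (Set.range s) := hs ▸ Submodule.mem_top
  obtain ⟨c, hc⟩ := (Submodule.mem_span_range_iff_exists_fun k).1 hx
  refine ⟨c, Ideal.Quotient.eq.1 ?_⟩
  rw [← hc, map_sum]
  refine Finset.sum_congr rfl fun i _ ↦ ?_
  rw [← ht i]
  rfl

theorem filterRegular_snoc_zero_iff (𝒜 : ℕ → Submodule k A) {r : ℕ} (h : Fin r → A) :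
    FilterRegular 𝒜 (Fin.snoc h (0 : A) : Fin (r + 1) → A) ↔
      FilterRegular 𝒜 h ∧ ∃ N : ℕ, ∀ n, N ≤ n → ∀ x ∈ 𝒜 n, x ∈ Ideal.span (Set.range h) := by
  have himage : ∀ i : Fin r, (Fin.snoc h (0 : A) : Fin (r + 1) → A) '' {j | j < i.castSucc} =
      h '' {j | j < i} := by
    intro i
    ext x
    simp [Fin.exists_fin_succ', Fin.castSucc_lt_castSucc_iff, (Fin.le_last _).not_gt]
  have hlast : (Fin.snoc h (0 : A) : Fin (r + 1) → A) '' {j | j < Fin.last r} = Set.range h := by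
    ext x
    simp [Fin.exists_fin_succ', Fin.castSucc_lt_last]
  unfold FilterRegular
  rw [Fin.forall_fin_succ']
  simp only [himage, hlast, Fin.snoc_castSucc, Fin.snoc_last, mul_zero, zero_mem, forall_const]

variable (𝒜 : ℕ → Submodule k A) [GradedAlgebra 𝒜]

theorem exists_forall_decompose_eq_zero {m : ℕ} (t : Fin m → A) :
    ∃ N : ℕ, ∀ n, N ≤ n → ∀ i, (decompose 𝒜 (t i) n : A) = 0 := by
  classical
  refine ⟨Finset.univ.sup (fun i ↦ (decompose 𝒜 (t i)).support.sup id) + 1, fun n hn i ↦ ?_⟩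
  by_contra hne
  have hmem : n ∈ (decompose 𝒜 (t i)).support :=
    DFinsupp.mem_support_iff.2 fun h0 ↦ hne (by simp [h0])
  have h1 : n ≤ (decompose 𝒜 (t i)).support.sup id := Finset.le_sup (f := id) hmem
  have h2 := Finset.le_sup (f := fun i ↦ (decompose 𝒜 (t i)).support.sup id)
    (Finset.mem_univ i)
  simp only at h2
  omega

theorem isHomogeneous_span_range {r : ℕ} {h : Fin r → A} (hpos : ∀ i, ∃ n, 0 < n ∧ h i ∈ 𝒜 n) :
    (Ideal.span (Set.range h)).IsHomogeneous 𝒜 := by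
  refine Ideal.homogeneous_span 𝒜 _ ?_
  rintro _ ⟨i, rfl⟩
  obtain ⟨n, -, hn⟩ := hpos i
  exact ⟨n, hn⟩

theorem eventually_le_of_finite_quotient {I : Ideal A} (hI : I.IsHomogeneous 𝒜)
    [FiniteDimensional k (A ⧸ I)] : ∃ N : ℕ, ∀ n, N ≤ n → ∀ x ∈ 𝒜 n, x ∈ I := by
  obtain ⟨m, t, ht⟩ := exists_lifts_of_finite_quotient (k := k) I
  obtain ⟨N, hN⟩ := exists_forall_decompose_eq_zero 𝒜 t
  refine ⟨N, fun n hn x hx ↦ ?_⟩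
  obtain ⟨c, hc⟩ := ht x
  have hproj := hI n hc
  rw [← GradedAlgebra.proj_apply, map_sub, map_sum] at hproj
  simpa [hN n hn, decompose_of_mem_same 𝒜 hx] using hproj

theorem finite_quotient_of_eventually_le [Algebra.FiniteType k A] (hconn : 𝒜 0 = 1) (I : Ideal A)
    {N : ℕ} (hN : ∀ n, N ≤ n → ∀ x ∈ 𝒜 n, x ∈ I) : FiniteDimensional k (A ⧸ I) := by
  classical
  have hhom : ∀ n, ∀ x ∈ 𝒜 n, IsIntegral k (Ideal.Quotient.mk I x) := by
    intro n x hx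
    rcases Nat.eq_zero_or_pos n with rfl | hn
    · rw [hconn, Submodule.mem_one] at hx
      obtain ⟨c, rfl⟩ := hx
      exact isIntegral_algebraMap (A := A ⧸ I) (x := c)
    · refine IsIntegral.of_pow (n := N + 1) N.succ_pos ?_
      rw [← map_pow, Ideal.Quotient.eq_zero_iff_mem.2 (hN ((N + 1) * n) (by nlinarith) _ ?_)]
      · exact isIntegral_zero
      · simpa using SetLike.pow_mem_graded (N + 1) hx
  have : Algebra.IsIntegral k (A ⧸ I) := by
    refine ⟨fun y ↦ ?_⟩
    obtain ⟨x, rfl⟩ := Ideal.Quotient.mk_surjective y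
    rw [← sum_support_decompose 𝒜 x, map_sum]
    exact IsIntegral.sum _ fun n _ ↦ hhom n _ (SetLike.coe_mem _)
  exact Algebra.IsIntegral.finite

theorem finite_adjoin_of_finite_quotient {r : ℕ} {h : Fin r → A}
    (hpos : ∀ i, ∃ n, 0 < n ∧ h i ∈ 𝒜 n)
    [FiniteDimensional k (A ⧸ Ideal.span (Set.range h))] :
    Module.Finite (Algebra.adjoin k (Set.range h)) A := by
  classical
  obtain ⟨m, t, ht⟩ := exists_lifts_of_finite_quotient (k := k) (Ideal.span (Set.range h))
  obtain ⟨N, hN⟩ := exists_forall_decompose_eq_zero 𝒜 t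
  choose e he hmem using hpos
  let u : Fin m × Fin N → A := fun p ↦ decompose 𝒜 (t p.1) p.2
  set M := Submodule.span (Algebra.adjoin k (Set.range h)) (Set.range u)
  have hu : ∀ i n, (decompose 𝒜 (t i) n : A) ∈ M := by
    intro i n
    by_cases hn : n < N
    · exact Submodule.subset_span ⟨(i, ⟨n, hn⟩), rfl⟩
    · rw [hN n (not_lt.1 hn) i]
      exact zero_mem M
  have hdeg : ∀ n, ∀ x ∈ 𝒜 n, x ∈ M := by
    intro n
    induction n using Nat.strong_induction_on with
    | _ n ih =>
      intro x hx
      obtain ⟨c, hc⟩ := ht x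
      obtain ⟨a, ha⟩ := Ideal.mem_span_range_iff_exists_fun.1 hc
      have hx' : x = ∑ i, a i * h i + ∑ i, c i • t i := by rw [ha, sub_add_cancel]
      have hxn := congrArg (GradedAlgebra.proj 𝒜 n) hx'
      rw [map_add, map_sum, map_sum] at hxn
      simp only [map_smul, GradedAlgebra.proj_apply, decompose_of_mem_same 𝒜 hx] at hxn
      rw [hxn]
      refine add_mem (sum_mem fun i _ ↦ ?_) (sum_mem fun i _ ↦ ?_)
      · rw [coe_decompose_mul_of_right_mem 𝒜 n (hmem i)]
        split_ifs with hle
        · rw [mul_comm]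
          exact M.smul_mem ⟨h i, Algebra.subset_adjoin ⟨i, rfl⟩⟩
            (ih (n - e i) (by have := he i; omega) _ (SetLike.coe_mem _))
        · exact zero_mem M
      · rw [Algebra.smul_def]
        exact M.smul_mem (algebraMap k (Algebra.adjoin k (Set.range h)) (c i)) (hu i n)
  have htop : M = ⊤ := eq_top_iff.2 fun x _ ↦ by
    rw [← sum_support_decompose 𝒜 x]
    exact sum_mem fun n _ ↦ hdeg n _ (SetLike.coe_mem _)
  exact ⟨htop ▸ Submodule.fg_span (Set.finite_range u)⟩

theorem ringKrullDim_adjoin_range_le {r : ℕ} (h : Fin r → A) :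
    ringKrullDim (Algebra.adjoin k (Set.range h)) ≤ r := by
  have hle : ringKrullDim (MvPolynomial.aeval (R := k) h).range ≤
      ringKrullDim (MvPolynomial (Fin r) k) :=
    ringKrullDim_le_of_surjective (MvPolynomial.aeval (R := k) h).rangeRestrict.toRingHom
      (MvPolynomial.aeval (R := k) h).rangeRestrict_surjective
  rw [Algebra.adjoin_range_eq_range_aeval]
  simpa [MvPolynomial.ringKrullDim_of_isNoetherianRing] using hle

theorem ringKrullDim_le_of_finite_quotient {r : ℕ} {h : Fin r → A}
    (hpos : ∀ i, ∃ n, 0 < n ∧ h i ∈ 𝒜 n)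
    [FiniteDimensional k (A ⧸ Ideal.span (Set.range h))] : ringKrullDim A ≤ r := by
  have := finite_adjoin_of_finite_quotient 𝒜 hpos
  exact (ringKrullDim_le_of_isIntegral (R := Algebra.adjoin k (Set.range h))).trans
    (ringKrullDim_adjoin_range_le h)

end GradedQuotient

theorem stmt0 {k A : Type*} [Field k] [CommRing A] [Algebra k A]
    (q : ℕ) (hq : 0 < q) [CharP k q]
    (𝒜 : ℕ → Submodule k A) [GradedAlgebra 𝒜]
    (hconn : 𝒜 0 = 1) [Algebra.FiniteType k A]
    {r : ℕ} (h : Fin r → A) (hpos : ∀ i, ∃ n, 0 < n ∧ h i ∈ 𝒜 n)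
    (d : ℕ) (hd : ringKrullDim A = d) :
    ((FilterRegular 𝒜 h ∧ r = d ∧
        FiniteDimensional k (A ⧸ Ideal.span (Set.range h))) ↔
      (FilterRegular 𝒜 h ∧ r ≤ d ∧
        FiniteDimensional k (A ⧸ Ideal.span (Set.range h)))) ∧
    ((FilterRegular 𝒜 h ∧ r = d ∧
        FiniteDimensional k (A ⧸ Ideal.span (Set.range h))) ↔
      (FilterRegular 𝒜 (Fin.snoc h (0 : A)) ∧ r ≤ d)) := by
  have hle : FiniteDimensional k (A ⧸ Ideal.span (Set.range h)) → d ≤ r := fun _ ↦ by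
    have := ringKrullDim_le_of_finite_quotient 𝒜 hpos
    rw [hd] at this
    exact_mod_cast this
  have hfin : FiniteDimensional k (A ⧸ Ideal.span (Set.range h)) ↔
      ∃ N : ℕ, ∀ n, N ≤ n → ∀ x ∈ 𝒜 n, x ∈ Ideal.span (Set.range h) :=
    ⟨fun _ ↦ eventually_le_of_finite_quotient 𝒜 (isHomogeneous_span_range 𝒜 hpos),
      fun ⟨_, hN⟩ ↦ finite_quotient_of_eventually_le 𝒜 hconn _ hN⟩
  have hdim : (FilterRegular 𝒜 h ∧ r = d ∧
        FiniteDimensional k (A ⧸ Ideal.span (Set.range h))) ↔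
      (FilterRegular 𝒜 h ∧ r ≤ d ∧
        FiniteDimensional k (A ⧸ Ideal.span (Set.range h))) :=
    ⟨fun ⟨h1, h2, h3⟩ ↦ ⟨h1, h2.le, h3⟩, fun ⟨h1, h2, h3⟩ ↦ ⟨h1, h2.antisymm (hle h3), h3⟩⟩
  refine ⟨hdim, hdim.trans ?_⟩
  rw [hfin]
  exact ⟨fun ⟨h1, h2, h3⟩ ↦ ⟨(filterRegular_snoc_zero_iff 𝒜 h).2 ⟨h1, h3⟩, h2⟩,
    fun ⟨h1, h2⟩ ↦ ⟨((filterRegular_snoc_zero_iff 𝒜 h).1 h1).1, h2,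
      ((filterRegular_snoc_zero_iff 𝒜 h).1 h1).2⟩⟩
end

section
/- Suppose that p_1, ..., p_r is a filter-regular sequence of homogeneous elements of A_+. Then there exists N such that for every homogeneous x ∈ A of degree at least N, if p_1·x lies in the ideal (p_2, ..., p_r) of A, then x itself lies in (p_2, ..., p_r). -/
/-- A homogeneous element of `I + (c)` is congruent modulo `I` to `c * y` with `y` homogeneous. -/
theorem Ideal.IsHomogeneous.exists_sub_mul_mem {k A : Type*} [Field k] [CommRing A] [Algebra k A]
    (𝒜 : ℕ → Submodule k A) [GradedAlgebra 𝒜] {I : Ideal A} (hI : I.IsHomogeneous 𝒜)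
    {c x : A} {d m : ℕ} (hdm : d ≤ m) (hc : c ∈ 𝒜 d) (hx : x ∈ 𝒜 m)
    (h : x ∈ Ideal.span {c} ⊔ I) : ∃ y ∈ 𝒜 (m - d), x - c * y ∈ I := by
  obtain ⟨u, hu, i, hi, hui⟩ := Submodule.mem_sup.1 h
  obtain ⟨y, rfl⟩ := Ideal.mem_span_singleton'.1 hu
  refine ⟨DirectSum.decompose 𝒜 y (m - d), SetLike.coe_mem _, ?_⟩
  rw [← DirectSum.coe_decompose_mul_of_left_mem_of_le 𝒜 hc hdm,
    ← DirectSum.decompose_of_mem_same 𝒜 hx]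
  have hxi : x - c * y = i := by rw [← hui]; ring
  have := hI m hi
  rw [← hxi, DirectSum.decompose_sub] at this
  simpa [DirectSum.decompose_of_mem_same 𝒜 hx] using this

/-- If `a` is filter-regular modulo `I` and `c` is filter-regular modulo `I + (a)`, then `a` is
filter-regular modulo `I + (c)`. -/
theorem filterRegular_swap {k A : Type*} [Field k] [CommRing A] [Algebra k A]
    (𝒜 : ℕ → Submodule k A) [GradedAlgebra 𝒜] {I : Ideal A} (hI : I.IsHomogeneous 𝒜)
    {a c : A} {d e : ℕ} (ha : a ∈ 𝒜 d) (hc : c ∈ 𝒜 e)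
    (hreg : ∃ N : ℕ, ∀ n, N ≤ n → ∀ x ∈ 𝒜 n, a * x ∈ I → x ∈ I)
    (hreg' : ∃ N : ℕ, ∀ n, N ≤ n → ∀ x ∈ 𝒜 n,
      x * c ∈ Ideal.span {a} ⊔ I → x ∈ Ideal.span {a} ⊔ I) :
    ∃ N : ℕ, ∀ n, N ≤ n → ∀ x ∈ 𝒜 n,
      a * x ∈ Ideal.span {c} ⊔ I → x ∈ Ideal.span {c} ⊔ I := by
  obtain ⟨N, hN⟩ := hreg
  obtain ⟨N', hN'⟩ := hreg'
  refine ⟨N + N' + e, fun n hn x hx hax ↦ ?_⟩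
  obtain ⟨y, hy, hxy⟩ := hI.exists_sub_mul_mem 𝒜 (by omega) hc (SetLike.mul_mem_graded ha hx) hax
  have hyc : y * c ∈ Ideal.span {a} ⊔ I := by
    have h₁ : a * x ∈ Ideal.span {a} ⊔ I :=
      Ideal.mul_mem_right _ _ (Ideal.mem_sup_left (Ideal.mem_span_singleton_self a))
    have h₂ := sub_mem h₁ (Ideal.mem_sup_right (S := Ideal.span {a}) hxy)
    rwa [sub_sub_cancel, mul_comm] at h₂
  obtain ⟨z, hz, hyz⟩ := hI.exists_sub_mul_mem 𝒜 (by omega) ha hy (hN' _ (by omega) y hy hyc)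
  have hcz : c * z ∈ 𝒜 n := by
    have := SetLike.mul_mem_graded hc hz
    rwa [show e + (d + n - e - d) = n by omega] at this
  have hxcz : x - c * z ∈ I := by
    refine hN n (by omega) _ (sub_mem hx hcz) ?_
    have := add_mem hxy (I.mul_mem_left c hyz)
    convert this using 1
    ring
  have := add_mem (Ideal.mem_sup_right (S := Ideal.span {c}) hxcz) (Ideal.mem_sup_left
    (Ideal.mul_mem_right z _ (Ideal.mem_span_singleton_self c)))
  rwa [sub_add_cancel] at this

theorem stmt1 {k A : Type*} [Field k] [CommRing A] [Algebra k A]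
    (q : ℕ) (hq : 0 < q) [CharP k q]
    (𝒜 : ℕ → Submodule k A) [GradedAlgebra 𝒜]
    (hconn : 𝒜 0 = 1) [Algebra.FiniteType k A]
    {r : ℕ} (p : Fin (r + 1) → A) (hpos : ∀ i, ∃ n, 0 < n ∧ p i ∈ 𝒜 n)
    (hfr : FilterRegular 𝒜 p) :
    ∃ N : ℕ, ∀ n : ℕ, N ≤ n → ∀ x ∈ 𝒜 n,
      p 0 * x ∈ Ideal.span (p '' {i | i ≠ 0}) →
        x ∈ Ideal.span (p '' {i | i ≠ 0}) := by
  have key : ∀ s ≤ r, ∃ N : ℕ, ∀ n : ℕ, N ≤ n → ∀ x ∈ 𝒜 n,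
      p 0 * x ∈ Ideal.span (p '' {i | i ≠ 0 ∧ i.val < s + 1}) →
        x ∈ Ideal.span (p '' {i | i ≠ 0 ∧ i.val < s + 1}) := by
    intro s
    induction s with
    | zero =>
      intro _
      obtain ⟨N, hN⟩ := hfr 0
      have h₁ : {i : Fin (r + 1) | i ≠ 0 ∧ i.val < 0 + 1} = {j | j < 0} := by
        ext i
        simp only [Set.mem_ofPred_eq, ne_eq, Fin.ext_iff, Fin.lt_def, Fin.val_zero]
        omega
      rw [h₁]
      exact ⟨N, fun n hn x hx h ↦ hN n hn x hx (by rwa [mul_comm])⟩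
    | succ s ih =>
      intro hs
      have hI : (Ideal.span (p '' {i | i ≠ 0 ∧ i.val < s + 1})).IsHomogeneous 𝒜 := by
        refine Ideal.homogeneous_span 𝒜 _ ?_
        rintro _ ⟨i, -, rfl⟩
        obtain ⟨n, -, hn⟩ := hpos i
        exact ⟨n, hn⟩
      obtain ⟨d, -, ha⟩ := hpos 0
      obtain ⟨e, -, hc⟩ := hpos ⟨s + 1, by omega⟩
      have h₁ : {i : Fin (r + 1) | i ≠ 0 ∧ i.val < s + 1 + 1} =
          insert ⟨s + 1, by omega⟩ {i | i ≠ 0 ∧ i.val < s + 1} := by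
        ext i
        simp only [Set.mem_ofPred_eq, Set.mem_insert_iff, Fin.ext_iff, ne_eq, Fin.val_zero]
        omega
      have h₂ : {j : Fin (r + 1) | j < ⟨s + 1, by omega⟩} =
          insert 0 {i | i ≠ 0 ∧ i.val < s + 1} := by
        ext i
        simp only [Set.mem_ofPred_eq, Set.mem_insert_iff, Fin.ext_iff, ne_eq, Fin.val_zero,
          Fin.lt_def]
        omega
      have hreg := hfr ⟨s + 1, by omega⟩
      rw [h₂, Set.image_insert_eq, Ideal.span_insert] at hreg
      rw [h₁, Set.image_insert_eq, Ideal.span_insert]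
      exact filterRegular_swap 𝒜 hI ha hc (ih (by omega)) hreg
  have h₁ : {i : Fin (r + 1) | i ≠ 0} = {i | i ≠ 0 ∧ i.val < r + 1} := by
    ext i
    exact (and_iff_left i.isLt).symm
  rw [h₁]
  exact key r le_rfl
end

section
/- Suppose that p_1, ..., p_r is a filter-regular sequence of homogeneous elements of A_+, and that f_1, ..., f_r are homogeneous elements of A_+ such that f_i divides p_i in A for each i. Then f_1, ..., f_r is also a filter-regular sequence. Consequently, if p_1, ..., p_r is a filter-regular homogeneous system of parameters for A, then so is f_1, ..., f_r. -/
open RingTheory.Sequence in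
/-- Over a Noetherian local ring, replacing each entry of a weakly regular sequence in the maximal
ideal by a non-unit divisor keeps the sequence weakly regular. -/
theorem RingTheory.Sequence.IsWeaklyRegular.of_forall₂_dvd {R : Type*} [CommRing R] [IsLocalRing R]
    [IsNoetherianRing R] {fs ps : List R} (hdvd : List.Forall₂ (· ∣ ·) fs ps)
    (hfs : ∀ f ∈ fs, f ∈ IsLocalRing.maximalIdeal R) (M : Type*) [AddCommGroup M] [Module R M]
    [Module.Finite R M] (h : IsWeaklyRegular M ps) : IsWeaklyRegular M fs := by
  induction hdvd generalizing M with
  | nil => exact .nil R M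
  | @cons f p fs ps hfp hrest ih =>
    rw [List.forall_mem_cons] at hfs
    have hps : ∀ x ∈ ps, x ∈ IsLocalRing.maximalIdeal R := by
      intro x hx
      obtain ⟨i, hi, rfl⟩ := List.mem_iff_getElem.mp hx
      have hi' : i < fs.length := by rw [hrest.length_eq]; exact hi
      exact Ideal.mem_of_dvd _ (hrest.get hi' hi) (hfs.2 _ (List.getElem_mem hi'))
    have hperm : IsWeaklyRegular M (ps ++ [p]) :=
      IsLocalRing.isWeaklyRegular_of_perm_of_subset_maximalIdeal h
        (List.perm_append_singleton p ps).symm <| by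
          rw [List.forall_mem_cons]
          exact ⟨Ideal.mem_of_dvd _ hfp hfs.1, hps⟩
    have hlast : IsWeaklyRegular M (ps ++ [f]) := by
      rw [isWeaklyRegular_append_iff, isWeaklyRegular_singleton_iff] at hperm ⊢
      obtain ⟨g, rfl⟩ := hfp
      exact ⟨hperm.1, ((mul_comm f g ▸ hperm.2).of_mul)⟩
    have hcons : IsWeaklyRegular M (f :: ps) :=
      IsLocalRing.isWeaklyRegular_of_perm_of_subset_maximalIdeal hlast
        (List.perm_append_singleton f ps) <| by
          simp only [List.mem_append, List.mem_singleton]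
          rintro x (hx | rfl)
          exacts [hps x hx, hfs.1]
    rw [isWeaklyRegular_cons_iff] at hcons ⊢
    exact ⟨hcons.1, ih hfs.2 _ hcons.2⟩

theorem Ideal.ofList_take_ofFn {R : Type*} [CommRing R] {n : ℕ} (a : Fin n → R) (i : Fin n) :
    Ideal.ofList ((List.ofFn a).take i) = Ideal.span (a '' {j | j < i}) := by
  refine congrArg Ideal.span (Set.ext fun x => ?_)
  simp only [Set.mem_ofPred_eq, List.mem_take_iff_getElem, List.length_ofFn, List.getElem_ofFn,
    Set.mem_image]
  constructor
  · rintro ⟨j, hj, rfl⟩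
    exact ⟨⟨j, by omega⟩, by simp only [Fin.lt_def]; omega, rfl⟩
  · rintro ⟨j, hj, rfl⟩
    exact ⟨j, by simp only [Fin.lt_def] at hj; omega, rfl⟩

theorem RingTheory.Sequence.isWeaklyRegular_ofFn_iff {R : Type*} [CommRing R] {n : ℕ}
    (a : Fin n → R) : IsWeaklyRegular R (List.ofFn a) ↔
      ∀ i x, x * a i ∈ Ideal.span (a '' {j | j < i}) → x ∈ Ideal.span (a '' {j | j < i}) := by
  have key (i : Fin n) : IsSMulRegular
      (R ⧸ (Ideal.ofList ((List.ofFn a).take i) • ⊤ : Submodule R R)) (a i) ↔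
      ∀ x, x * a i ∈ Ideal.span (a '' {j | j < i}) → x ∈ Ideal.span (a '' {j | j < i}) := by
    rw [isSMulRegular_quotient_iff_mem_of_smul_mem, Ideal.ofList_take_ofFn, smul_eq_mul,
      Ideal.mul_top]
    simp only [smul_eq_mul, mul_comm]
  constructor
  · intro h i
    rw [← key]
    simpa using h.regular_mod_prev i (by simp)
  · refine fun h => ⟨fun i hi => ?_⟩
    rw [List.getElem_ofFn]
    exact (key ⟨i, by simpa using hi⟩).mpr (h _)

open RingTheory.Sequence in
/-- A sequence whose image in the localization at a prime ideal is weakly regular can be replaced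
by a sequence of divisors lying in that prime ideal. -/
theorem Ideal.IsPrime.exists_mul_mem_span_of_dvd {A : Type*} [CommRing A] [IsNoetherianRing A]
    (P : Ideal A) [P.IsPrime] {n : ℕ} {a b : Fin n → A} (hdvd : ∀ j, b j ∣ a j)
    (hb : ∀ j, b j ∈ P)
    (ha : ∀ i x, x * a i ∈ Ideal.span (a '' {j | j < i}) →
      ∃ s ∉ P, s * x ∈ Ideal.span (a '' {j | j < i}))
    (i : Fin n) {x : A} (hx : x * b i ∈ Ideal.span (b '' {j | j < i})) :
    ∃ s ∉ P, s * x ∈ Ideal.span (b '' {j | j < i}) := by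
  let R := Localization.AtPrime P
  have : IsNoetherianRing R := IsLocalization.isNoetherianRing P.primeCompl R inferInstance
  let φ := algebraMap A R
  have hspan (c : Fin n → A) (i : Fin n) : Ideal.span ((φ ∘ c) '' {j | j < i}) =
      (Ideal.span (c '' {j | j < i})).map φ := by
    rw [Ideal.map_span, Set.image_comp]
  have hmem (I : Ideal A) (x : A) : φ x ∈ I.map φ ↔ ∃ s ∉ P, s * x ∈ I :=
    IsLocalization.algebraMap_mem_map_algebraMap_iff P.primeCompl R I x
  have hreg : IsWeaklyRegular R (List.ofFn (φ ∘ a)) := by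
    rw [isWeaklyRegular_ofFn_iff]
    intro i y hy
    obtain ⟨x, s, rfl⟩ := IsLocalization.exists_mk'_eq P.primeCompl y
    rw [hspan] at hy ⊢
    have hy' : φ (x * a i) ∈ (Ideal.span (a '' {j | j < i})).map φ := by
      have := Ideal.mul_mem_left _ (φ s) hy
      rwa [← mul_assoc, IsLocalization.mk'_spec', Function.comp_apply, ← map_mul] at this
    obtain ⟨u, hu, hux⟩ := (hmem _ _).mp hy'
    obtain ⟨v, hv, hvx⟩ := ha i (u * x) (by rwa [mul_assoc])
    have hxm : φ x ∈ (Ideal.span (a '' {j | j < i})).map φ :=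
      (hmem _ _).mpr ⟨v * u, P.primeCompl.mul_mem hv hu, by rwa [mul_assoc]⟩
    rw [IsLocalization.mk'_eq_mul_mk'_one]
    exact Ideal.mul_mem_right _ _ hxm
  have hregb : IsWeaklyRegular R (List.ofFn (φ ∘ b)) := by
    refine hreg.of_forall₂_dvd ?_ ?_ R
    · rw [List.forall₂_iff_get]
      refine ⟨by simp, fun j h₁ h₂ => ?_⟩
      simpa using map_dvd φ (hdvd _)
    · intro f hf
      obtain ⟨j, rfl⟩ := List.mem_ofFn.mp hf
      exact (IsLocalization.AtPrime.to_map_mem_maximal_iff R P (b j)).mpr (hb j)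
  rw [← hmem, ← hspan]
  refine (isWeaklyRegular_ofFn_iff _).mp hregb i (φ x) ?_
  rw [hspan, Function.comp_apply, ← map_mul]
  exact Ideal.mem_map_of_mem φ hx

open DirectSum in
theorem Ideal.IsPrime.isMaximal_of_homogeneous_mem {k A : Type*} [Field k] [CommRing A]
    [Algebra k A] (𝒜 : ℕ → Submodule k A) [GradedAlgebra 𝒜] (hconn : 𝒜 0 = 1) {P : Ideal A}
    (hP : P.IsPrime) (h : ∀ d, 0 < d → ∀ t ∈ 𝒜 d, t ∈ P) : P.IsMaximal := by
  refine Ideal.isMaximal_iff.mpr ⟨(Ideal.ne_top_iff_one P).mp hP.ne_top, fun J x hPJ hxP hxJ => ?_⟩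
  have hrest : x - (decompose 𝒜 x 0 : A) ∈ P := by
    classical
    have hsum := sum_support_decompose 𝒜 x
    by_cases h0 : 0 ∈ (decompose 𝒜 x).support
    · rw [← Finset.add_sum_erase _ _ h0] at hsum
      nth_rw 1 [← hsum]
      rw [add_sub_cancel_left]
      exact Ideal.sum_mem _ fun d hd =>
        h d (Nat.pos_of_ne_zero (Finset.ne_of_mem_erase hd)) _ (SetLike.coe_mem _)
    · rw [DFinsupp.notMem_support_iff.mp h0, ZeroMemClass.coe_zero, sub_zero, ← hsum]
      exact Ideal.sum_mem _ fun d hd =>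
        h d (Nat.pos_of_ne_zero fun e => h0 (e ▸ hd)) _ (SetLike.coe_mem _)
  have hx0 : (decompose 𝒜 x 0 : A) ∈ 𝒜 0 := SetLike.coe_mem _
  obtain ⟨c, hc⟩ := Submodule.mem_one.mp (hconn.le hx0)
  rw [← hc] at hrest
  have hc0 : c ≠ 0 := by
    rintro rfl
    exact hxP (by simpa using hrest)
  have hcJ : algebraMap k A c ∈ J := by simpa using J.sub_mem hxJ (hPJ hrest)
  have := J.mul_mem_left (algebraMap k A c⁻¹) hcJ
  rwa [← map_mul, inv_mul_cancel₀ hc0, map_one] at this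

open DirectSum in
theorem Ideal.IsHomogeneous.exists_forall_ge_mem_of_finiteDimensional {k A : Type*} [Field k]
    [CommRing A] [Algebra k A] (𝒜 : ℕ → Submodule k A) [GradedAlgebra 𝒜] {J : Ideal A}
    (hJ : J.IsHomogeneous 𝒜) (V : Submodule k (A ⧸ J)) [FiniteDimensional k V] :
    ∃ N : ℕ, ∀ n, N ≤ n → ∀ x ∈ 𝒜 n, Ideal.Quotient.mk J x ∈ V → x ∈ J := by
  let G (n : ℕ) : Submodule k A := ⨅ m : Fin n, LinearMap.ker (GradedAlgebra.proj 𝒜 m)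
  have hG (n : ℕ) (a : A) : a ∈ G n ↔ ∀ m < n, (decompose 𝒜 a m : A) = 0 := by
    simp [G, Submodule.mem_iInf, Fin.forall_iff, GradedAlgebra.proj_apply]
  let F : ℕ →o (Submodule k V)ᵒᵈ :=
    { toFun n := OrderDual.toDual
        (((G n).map (Ideal.Quotient.mkₐ k J).toLinearMap).comap V.subtype)
      monotone' m n hmn := by
        refine OrderDual.toDual_le_toDual.mpr (Submodule.comap_mono (Submodule.map_mono ?_))
        intro a ha
        rw [hG] at ha ⊢
        exact fun i hi => ha i (hi.trans_le hmn) }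
  obtain ⟨N, hN⟩ := IsArtinian.monotone_stabilizes F
  refine ⟨N, fun n hn x hx hxV => ?_⟩
  have hF : F n = F (n + 1) := (hN n hn).symm.trans (hN (n + 1) (by omega))
  have hxF : (⟨Ideal.Quotient.mk J x, hxV⟩ : V) ∈ OrderDual.ofDual (F n) :=
    ⟨x, (hG n x).mpr fun m hm => decompose_of_mem_ne 𝒜 hx hm.ne', rfl⟩
  rw [hF] at hxF
  obtain ⟨y, hy, hyx⟩ := hxF
  have hyJ : y - x ∈ J := Ideal.Quotient.eq.mp hyx
  have := hJ n hyJ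
  rw [decompose_sub, DirectSum.sub_apply, AddSubgroupClass.coe_sub, (hG _ _).mp hy n (by omega),
    decompose_of_mem_same 𝒜 hx, zero_sub] at this
  exact neg_mem_iff.mp this

theorem Module.finite_of_forall_mem_support_isMaximal {k A M : Type*} [Field k] [CommRing A]
    [Algebra k A] [Algebra.FiniteType k A] [AddCommGroup M] [Module A M] [Module k M]
    [IsScalarTower k A M] [Module.Finite A M]
    (h : ∀ P ∈ Module.support A M, P.asIdeal.IsMaximal) : Module.Finite k M := by
  let I := Module.annihilator A M
  have : Ring.KrullDimLE 0 (A ⧸ I) := .mk₀ fun Q hQ => by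
    have hI : I ≤ Q.comap (Ideal.Quotient.mk I) := by
      conv_lhs => rw [← Ideal.mk_ker (I := I)]
      exact Ideal.comap_mono bot_le
    have hmax : (Q.comap (Ideal.Quotient.mk I)).IsMaximal :=
      h ⟨_, hQ.comap _⟩ (Module.mem_support_iff_of_finite.mpr hI)
    rw [← Ideal.map_comap_of_surjective _ Ideal.Quotient.mk_surjective Q]
    refine (Ideal.map_eq_top_or_isMaximal_of_surjective _ Ideal.Quotient.mk_surjective
      hmax).resolve_left ?_
    rw [Ideal.map_comap_of_surjective _ Ideal.Quotient.mk_surjective]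
    exact hQ.ne_top
  have : Module.Finite k (A ⧸ I) :=
    (Module.finite_iff_krullDimLE_zero k _).mpr this
  let : Module (A ⧸ I) M := Module.IsTorsionBySet.module (I := I) fun x a =>
    Module.mem_annihilator.mp a.2 x
  have : IsScalarTower A (A ⧸ I) M := Module.IsTorsionBySet.isScalarTower _
  have : IsScalarTower k (A ⧸ I) M := Module.IsTorsionBySet.isScalarTower _
  have : Module.Finite (A ⧸ I) M := .of_restrictScalars_finite A _ _
  exact .trans (A ⧸ I) M

open DirectSum in
theorem FilterRegular.exists_mul_mem_span {k A : Type*} [Field k] [CommRing A] [Algebra k A]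
    {𝒜 : ℕ → Submodule k A} [GradedAlgebra 𝒜] {r : ℕ} {p : Fin r → A}
    (hp : ∀ i, ∃ n, 0 < n ∧ p i ∈ 𝒜 n) (h : FilterRegular 𝒜 p) {P : Ideal A} [P.IsPrime]
    {d : ℕ} (hd : 0 < d) {t : A} (ht : t ∈ 𝒜 d) (htP : t ∉ P) (i : Fin r) {x : A}
    (hx : x * p i ∈ Ideal.span (p '' {j | j < i})) :
    ∃ s ∉ P, s * x ∈ Ideal.span (p '' {j | j < i}) := by
  classical
  obtain ⟨N, hN⟩ := h i
  obtain ⟨e, -, he⟩ := hp i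
  have hJ : (Ideal.span (p '' {j | j < i})).IsHomogeneous 𝒜 := by
    refine Ideal.homogeneous_span 𝒜 _ ?_
    rintro _ ⟨j, -, rfl⟩
    obtain ⟨m, -, hm⟩ := hp j
    exact ⟨m, hm⟩
  refine ⟨t ^ N, fun hmem => htP (Ideal.IsPrime.mem_of_pow_mem ‹_› _ hmem), ?_⟩
  rw [← sum_support_decompose 𝒜 x, Finset.mul_sum]
  refine Ideal.sum_mem _ fun n _ => hN (N • d + n) ?_ _
    (SetLike.mul_mem_graded (SetLike.pow_mem_graded N ht) (SetLike.coe_mem _)) ?_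
  · rw [smul_eq_mul]
    exact (Nat.le_mul_of_pos_right N hd).trans (Nat.le_add_right _ _)
  · rw [mul_assoc, ← coe_decompose_mul_add_of_right_mem 𝒜 he]
    exact Ideal.mul_mem_left _ _ (hJ _ hx)

theorem FilterRegular.of_dvd {k A : Type*} [Field k] [CommRing A] [Algebra k A]
    {𝒜 : ℕ → Submodule k A} [GradedAlgebra 𝒜] (hconn : 𝒜 0 = 1) [Algebra.FiniteType k A]
    {r : ℕ} {p f : Fin r → A} (hp : ∀ i, ∃ n, 0 < n ∧ p i ∈ 𝒜 n)
    (hf : ∀ i, ∃ n, 0 < n ∧ f i ∈ 𝒜 n) (hdvd : ∀ i, f i ∣ p i) (h : FilterRegular 𝒜 p) :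
    FilterRegular 𝒜 f := by
  have : IsNoetherianRing A := Algebra.FiniteType.isNoetherianRing k A
  intro i
  set J := Ideal.span (f '' {j | j < i}) with hJdef
  have hJ : J.IsHomogeneous 𝒜 := by
    refine Ideal.homogeneous_span 𝒜 _ ?_
    rintro _ ⟨j, -, rfl⟩
    obtain ⟨m, -, hm⟩ := hf j
    exact ⟨m, hm⟩
  have hlocal (P : Ideal A) [P.IsPrime] (hP : ¬ P.IsMaximal) (x : A) (hx : x * f i ∈ J) :
      ∃ s ∉ P, s * x ∈ J := by
    obtain ⟨d, hd, t, ht, htP⟩ : ∃ d, 0 < d ∧ ∃ t ∈ 𝒜 d, t ∉ P := by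
      by_contra! hcon
      exact hP (Ideal.IsPrime.isMaximal_of_homogeneous_mem 𝒜 hconn ‹_› hcon)
    by_cases hfP : ∀ j ≤ i, f j ∈ P
    · have himage (c : Fin r → A) (j : Fin (i + 1)) :
          (fun l => c (Fin.castLE i.2 l)) '' {l | l < j} =
            c '' {l | l < Fin.castLE i.2 j} := by
        ext y
        constructor
        · rintro ⟨l, hl, rfl⟩
          exact ⟨Fin.castLE i.2 l, hl, rfl⟩
        · rintro ⟨l, hl, rfl⟩
          have hl' : (l : ℕ) < j := hl
          exact ⟨⟨l, hl'.trans j.2⟩, hl', rfl⟩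
      have := Ideal.IsPrime.exists_mul_mem_span_of_dvd P
        (a := fun l => p (Fin.castLE i.2 l)) (b := fun l => f (Fin.castLE i.2 l))
        (fun l => hdvd _) (fun l => hfP _ (Nat.lt_succ_iff.mp l.2))
        (fun l y hy => by
          rw [himage] at hy ⊢
          exact h.exists_mul_mem_span hp hd ht htP _ hy)
        (Fin.last i) (x := x) (by rw [himage]; exact hx)
      rw [himage] at this
      exact this
    · push Not at hfP
      obtain ⟨j, hj, hjP⟩ := hfP
      refine ⟨f j, hjP, ?_⟩
      rcases hj.lt_or_eq with hj | rfl
      · exact J.mul_mem_right _ (Ideal.subset_span ⟨j, hj, rfl⟩)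
      · rwa [mul_comm]
  let V : Submodule A (A ⧸ J) := LinearMap.ker (LinearMap.lsmul A (A ⧸ J) (f i))
  have hV (x : A) : Ideal.Quotient.mk J x ∈ V ↔ x * f i ∈ J := by
    rw [mul_comm, ← Ideal.Quotient.eq_zero_iff_mem]
    rfl
  have hfin : Module.Finite k V := Module.finite_of_forall_mem_support_isMaximal (A := A) <| by
    intro P hPsupp
    by_contra hP
    refine Module.notMem_support_iff'.mpr ?_ hPsupp
    rintro ⟨y, hy⟩
    obtain ⟨x, rfl⟩ := Ideal.Quotient.mk_surjective y
    obtain ⟨s, hs, hsx⟩ := hlocal P.asIdeal hP x ((hV x).mp hy)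
    exact ⟨s, hs, Subtype.ext (Ideal.Quotient.eq_zero_iff_mem.mpr hsx)⟩
  have : FiniteDimensional k (V.restrictScalars k) := hfin
  obtain ⟨N, hN⟩ := hJ.exists_forall_ge_mem_of_finiteDimensional 𝒜 (V.restrictScalars k)
  exact ⟨N, fun n hn x hx hxf => hN n hn x hx ((hV x).mpr hxf)⟩

theorem stmt2 {k A : Type*} [Field k] [CommRing A] [Algebra k A]
    (q : ℕ) (hq : 0 < q) [CharP k q]
    (𝒜 : ℕ → Submodule k A) [GradedAlgebra 𝒜]
    (hconn : 𝒜 0 = 1) [Algebra.FiniteType k A]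
    {r : ℕ} (p f : Fin r → A)
    (hppos : ∀ i, ∃ n, 0 < n ∧ p i ∈ 𝒜 n)
    (hfpos : ∀ i, ∃ n, 0 < n ∧ f i ∈ 𝒜 n)
    (hdvd : ∀ i, f i ∣ p i)
    (hfr : FilterRegular 𝒜 p) :
    FilterRegular 𝒜 f ∧
      ((ringKrullDim A = (r : ℕ) ∧
          FiniteDimensional k (A ⧸ Ideal.span (Set.range p))) →
        (ringKrullDim A = (r : ℕ) ∧
          FiniteDimensional k (A ⧸ Ideal.span (Set.range f)))) := by
  refine ⟨hfr.of_dvd hconn hppos hfpos hdvd, fun ⟨hdim, hfin⟩ => ⟨hdim, ?_⟩⟩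
  have hle : Ideal.span (Set.range p) ≤ Ideal.span (Set.range f) := by
    rw [Ideal.span_le]
    rintro _ ⟨i, rfl⟩
    exact Ideal.mem_of_dvd _ (hdvd i) (Ideal.subset_span ⟨i, rfl⟩)
  exact Module.Finite.of_surjective (Ideal.Quotient.factorₐ k hle).toLinearMap
    (Ideal.Quotient.factor_surjective hle)
end

section
/- Suppose that f_1, ..., f_r and g_1, ..., g_r are two sequences of homogeneous elements of A_+ such that for each i the difference g_i − f_i is nilpotent in A. Then f_1, ..., f_r is a filter-regular sequence if and only if g_1, ..., g_r is a filter-regular sequence. -/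
/-- A sequence of ring elements is weakly regular if each one is a nonzerodivisor modulo the
ideal generated by the previous ones. -/
def WeaklyRegularSeq {S : Type*} [CommRing S] {r : ℕ} (h : Fin r → S) : Prop :=
  ∀ (i : Fin r) (y : S),
    y * h i ∈ Ideal.span (h '' {j | j < i}) → y ∈ Ideal.span (h '' {j | j < i})

section PowerShift

variable {S : Type*} [CommRing S]

/-- Multiplication by `x ^ b` induces an injection `S/(L, x ^ a) → S/(L, x ^ (a + b))`. -/
def PowShiftInjective (L : Ideal S) (x : S) : Prop :=
  ∀ (a b : ℕ) (y : S), x ^ b * y ∈ Ideal.span {x ^ (a + b)} ⊔ L → y ∈ Ideal.span {x ^ a} ⊔ L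

theorem mem_of_mul_pow_mem {L : Ideal S} {x : S} (hx : ∀ y, y * x ∈ L → y ∈ L) (b : ℕ) (y : S)
    (h : y * x ^ b ∈ L) : y ∈ L := by
  induction b with
  | zero => simpa using h
  | succ b ih => exact ih (hx _ (by rwa [mul_assoc, ← pow_succ]))

theorem powShiftInjective_of_regular {L : Ideal S} {x : S} (hx : ∀ y, y * x ∈ L → y ∈ L) :
    PowShiftInjective L x := by
  intro a b y hy
  obtain ⟨z, l, hl, e⟩ := Ideal.mem_span_singleton_sup.1 hy
  refine Ideal.mem_span_singleton_sup.2 ⟨z, y - z * x ^ a, ?_, by ring⟩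
  refine mem_of_mul_pow_mem hx b _ ?_
  rwa [show (y - z * x ^ a) * x ^ b = l by linear_combination -e]

theorem PowShiftInjective.sup {L : Ideal S} {x s : S} (hE : PowShiftInjective L x)
    (hs : ∀ (b : ℕ) (y : S), y * s ∈ Ideal.span {x ^ b} ⊔ L → y ∈ Ideal.span {x ^ b} ⊔ L) :
    PowShiftInjective (Ideal.span {s} ⊔ L) x := by
  intro a b y hy
  rw [sup_left_comm] at hy ⊢
  obtain ⟨z, u, hu, e⟩ := Ideal.mem_span_singleton_sup.1 hy
  obtain ⟨c, l, hl, equ⟩ := Ideal.mem_span_singleton_sup.1 hu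
  have hz : z ∈ Ideal.span {x ^ b} ⊔ L := by
    refine hs b z (Ideal.mem_span_singleton_sup.2 ⟨y - c * x ^ a, -l, L.neg_mem hl, ?_⟩)
    linear_combination -e - equ
  obtain ⟨d, v, hv, eqv⟩ := Ideal.mem_span_singleton_sup.1 hz
  refine Ideal.mem_span_singleton_sup.2 ⟨d, y - d * s, hE a b _ ?_, by ring⟩
  refine Ideal.mem_span_singleton_sup.2
    ⟨c, l + s * v, L.add_mem hl (L.mul_mem_left _ hv), ?_⟩
  linear_combination e + equ + s * eqv

/-- If `s` is a nonzerodivisor modulo `(L, x ^ n)` for one `n > 0`, it is so for all `n`. -/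
theorem PowShiftInjective.regular_of_regular {L : Ideal S} {x s : S}
    (hE : PowShiftInjective L x) {n : ℕ} (hn : 0 < n)
    (hs : ∀ y, y * s ∈ Ideal.span {x ^ n} ⊔ L → y ∈ Ideal.span {x ^ n} ⊔ L) (m : ℕ) (y : S)
    (hy : y * s ∈ Ideal.span {x ^ m} ⊔ L) : y ∈ Ideal.span {x ^ m} ⊔ L := by
  have h1 : ∀ y, y * s ∈ Ideal.span {x ^ 1} ⊔ L → y ∈ Ideal.span {x ^ 1} ⊔ L := by
    intro y hy
    refine hE 1 (n - 1) y ?_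
    rw [show 1 + (n - 1) = n by omega]
    refine hs _ ?_
    obtain ⟨c, l, hl, e⟩ := Ideal.mem_span_singleton_sup.1 hy
    refine Ideal.mem_span_singleton_sup.2 ⟨c, x ^ (n - 1) * l, L.mul_mem_left _ hl, ?_⟩
    obtain ⟨k, rfl⟩ : ∃ k, n = k + 1 := ⟨n - 1, by omega⟩
    simp only [Nat.add_sub_cancel]
    linear_combination x ^ k * e
  induction m generalizing y with
  | zero => simp
  | succ m ih =>
    obtain ⟨c, l, hl, e⟩ := Ideal.mem_span_singleton_sup.1 hy
    obtain ⟨z, v, hv, equ⟩ := Ideal.mem_span_singleton_sup.1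
      (ih y (Ideal.mem_span_singleton_sup.2 ⟨c * x, l, hl, by linear_combination e⟩))
    have hz : z * s ∈ Ideal.span {x ^ 1} ⊔ L := by
      refine hE 1 m _ (Ideal.mem_span_singleton_sup.2
        ⟨c, l - s * v, L.sub_mem hl (L.mul_mem_left _ hv), ?_⟩)
      linear_combination e - s * equ
    obtain ⟨d, w, hw, eqv⟩ := Ideal.mem_span_singleton_sup.1 (h1 z hz)
    refine Ideal.mem_span_singleton_sup.2
      ⟨d, v + x ^ m * w, L.add_mem hv (L.mul_mem_left _ hw), ?_⟩
    linear_combination equ + x ^ m * eqv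

variable {r : ℕ}

theorem span_image_update_of_le (h : Fin r → S) {t i : Fin r} (hi : i ≤ t) (z : S) :
    Ideal.span (Function.update h t z '' {j | j < i}) =
      Ideal.span (h '' {j | (j : ℕ) < i ∧ j ≠ t}) := by
  congr 1
  have : {j : Fin r | (j : ℕ) < i ∧ j ≠ t} = {j | j < i} := by
    ext j
    simp only [Set.mem_ofPred_eq, ← Fin.lt_def, and_iff_left_iff_imp]
    exact fun hj => (hj.trans_le hi).ne
  rw [this]
  refine Set.image_congr fun j hj => Function.update_of_ne ?_ _ _
  exact (lt_of_lt_of_le hj hi).ne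

theorem span_image_update_of_lt (h : Fin r → S) {t i : Fin r} (hi : t < i) (z : S) :
    Ideal.span (Function.update h t z '' {j | j < i}) =
      Ideal.span {z} ⊔ Ideal.span (h '' {j | (j : ℕ) < i ∧ j ≠ t}) := by
  rw [← Ideal.span_union]
  congr 1
  have : {j : Fin r | j < i} = {t} ∪ {j : Fin r | (j : ℕ) < i ∧ j ≠ t} := by
    ext j
    by_cases hj : j = t
    · simp [hj, hi]
    · simp [hj]
  rw [this, Set.image_union, Set.image_singleton, Function.update_self]
  congr 1
  exact Set.image_congr fun j hj => Function.update_of_ne hj.2 _ _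

theorem WeaklyRegularSeq.update_pow {h : Fin r → S} {t : Fin r} {n m : ℕ} (hn : 0 < n)
    (H : WeaklyRegularSeq (Function.update h t (h t ^ n))) :
    WeaklyRegularSeq (Function.update h t (h t ^ m)) := by
  have hx : ∀ y, y * h t ∈ Ideal.span (h '' {j | (j : ℕ) < t ∧ j ≠ t}) →
      y ∈ Ideal.span (h '' {j | (j : ℕ) < t ∧ j ≠ t}) := by
    intro y hy
    have := H t y
    rw [span_image_update_of_le h le_rfl, Function.update_self] at this
    refine this ?_
    obtain ⟨k, rfl⟩ : ∃ k, n = k + 1 := ⟨n - 1, by omega⟩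
    rw [pow_succ', ← mul_assoc]
    exact Ideal.mul_mem_right _ _ hy
  have hH : ∀ i, t < i → ∀ y,
      y * h i ∈ Ideal.span {h t ^ n} ⊔ Ideal.span (h '' {j | (j : ℕ) < i ∧ j ≠ t}) →
      y ∈ Ideal.span {h t ^ n} ⊔ Ideal.span (h '' {j | (j : ℕ) < i ∧ j ≠ t}) := by
    intro i hi y hy
    have := H i y
    rw [span_image_update_of_lt h hi, Function.update_of_ne hi.ne'] at this
    exact this hy
  have hE : ∀ k : ℕ, (t : ℕ) + 1 ≤ k → k ≤ r →
      PowShiftInjective (Ideal.span (h '' {j | (j : ℕ) < k ∧ j ≠ t})) (h t) := by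
    intro k hk
    induction k, hk using Nat.le_induction with
    | base =>
      intro _
      have : {j : Fin r | (j : ℕ) < t + 1 ∧ j ≠ t} = {j : Fin r | (j : ℕ) < t ∧ j ≠ t} := by
        ext j
        simp only [Set.mem_ofPred_eq, ne_eq, Fin.ext_iff]
        omega
      rw [this]
      exact powShiftInjective_of_regular hx
    | succ k hk ih =>
      intro hkr
      have : {j : Fin r | (j : ℕ) < k + 1 ∧ j ≠ t} =
          {⟨k, hkr⟩} ∪ {j : Fin r | (j : ℕ) < k ∧ j ≠ t} := by
        ext j
        simp only [Set.mem_ofPred_eq, ne_eq, Fin.ext_iff, Set.mem_union, Set.mem_singleton_iff]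
        omega
      rw [this, Set.image_union, Set.image_singleton, Ideal.span_union]
      have hE := ih (by omega)
      exact hE.sup (hE.regular_of_regular hn (hH ⟨k, hkr⟩ hk))
  intro i y hy
  rcases lt_trichotomy i t with hi | rfl | hi
  · have := H i y
    rw [span_image_update_of_le h hi.le, Function.update_of_ne hi.ne] at this
    rw [span_image_update_of_le h hi.le] at hy ⊢
    rw [Function.update_of_ne hi.ne] at hy
    exact this hy
  · rw [span_image_update_of_le h le_rfl] at hy ⊢
    rw [Function.update_self] at hy
    exact mem_of_mul_pow_mem hx m y hy
  · rw [span_image_update_of_lt h hi] at hy ⊢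
    rw [Function.update_of_ne hi.ne'] at hy
    exact (hE i hi i.2.le).regular_of_regular hn (hH i hi) m y hy

theorem weaklyRegularSeq_pow_iff (h : Fin r → S) {n : ℕ} (hn : 0 < n) :
    WeaklyRegularSeq (fun i => h i ^ n) ↔ WeaklyRegularSeq h := by
  have key : ∀ s : Finset (Fin r),
      WeaklyRegularSeq (fun i => if i ∈ s then h i ^ n else h i) ↔ WeaklyRegularSeq h := by
    intro s
    induction s using Finset.induction_on with
    | empty => simp
    | insert t s ht ih =>
      rw [← ih]
      set g : Fin r → S := fun i => if i ∈ s then h i ^ n else h i with hg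
      have e1 : (fun i => if i ∈ insert t s then h i ^ n else h i) =
          Function.update g t (g t ^ n) := by
        ext i
        by_cases hi : i = t
        · subst hi; simp [hg, ht]
        · simp [hg, hi]
      have e2 : g = Function.update g t (g t ^ 1) := by simp
      rw [e1]
      constructor
      · intro H
        rw [e2]
        exact H.update_pow hn
      · intro H
        rw [e2] at H
        exact H.update_pow one_pos
  simpa using key Finset.univ

end PowerShift

section Localization

variable {A : Type*} [CommRing A] {r : ℕ}

theorem algebraMap_away_mem_map_iff (w : A) (I : Ideal A) (x : A) :
    algebraMap A (Localization.Away w) x ∈ I.map (algebraMap A (Localization.Away w)) ↔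
      ∃ N, w ^ N * x ∈ I := by
  rw [IsLocalization.algebraMap_mem_map_algebraMap_iff (Submonoid.powers w)]
  simp [Submonoid.mem_powers_iff]

theorem weaklyRegularSeq_away_iff (w : A) (h : Fin r → A) :
    WeaklyRegularSeq (fun i => algebraMap A (Localization.Away w) (h i)) ↔
      ∀ (i : Fin r) (y : A), y * h i ∈ Ideal.span (h '' {j | j < i}) →
        ∃ N, w ^ N * y ∈ Ideal.span (h '' {j | j < i}) := by
  have e : ∀ i : Fin r,
      Ideal.span ((fun i => algebraMap A (Localization.Away w) (h i)) '' {j | j < i}) =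
        (Ideal.span (h '' {j | j < i})).map (algebraMap A (Localization.Away w)) := by
    intro i
    rw [Ideal.map_span, Set.image_image]
  constructor
  · intro H i y hy
    rw [← algebraMap_away_mem_map_iff, ← e]
    refine H i _ ?_
    rw [e, ← map_mul]
    exact Ideal.mem_map_of_mem _ hy
  · intro H i z hz
    rw [e] at hz ⊢
    obtain ⟨⟨y, s⟩, hys⟩ := IsLocalization.surj (Submonoid.powers w) z
    have hs : IsUnit (algebraMap A (Localization.Away w) s) :=
      IsLocalization.map_units _ s
    dsimp only at hys
    have hy : algebraMap A (Localization.Away w) (y * h i) ∈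
        (Ideal.span (h '' {j | j < i})).map (algebraMap A (Localization.Away w)) := by
      rw [map_mul, ← hys, mul_right_comm]
      exact Ideal.mul_mem_right _ _ hz
    obtain ⟨N, hN⟩ := (algebraMap_away_mem_map_iff _ _ _).1 hy
    rw [← mul_assoc] at hN
    obtain ⟨M, hM⟩ := H i _ hN
    rw [← Ideal.mul_unit_mem_iff_mem _ hs, hys]
    exact (algebraMap_away_mem_map_iff _ _ _).2 ⟨M + N, by rwa [pow_add, mul_assoc]⟩

end Localization

section Graded

open HomogeneousIdeal

variable {k A : Type*} [Field k] [CommRing A] [Algebra k A]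
  (𝒜 : ℕ → Submodule k A) [GradedAlgebra 𝒜]

theorem Ideal.IsHomogeneous.exists_decompose_mul_mem {J : Ideal A} (hJ : J.IsHomogeneous 𝒜)
    {y : A} (hy : y ∈ J) :
    ∃ D : ℕ, ∀ (a : A) (n : ℕ), D ≤ n →
      (DirectSum.decompose 𝒜 (a * y) n : A) ∈ (irrelevant 𝒜).toIdeal * J := by
  classical
  rw [← DirectSum.sum_support_decompose 𝒜 y]
  refine Finset.sum_induction _ (fun y => ∃ D : ℕ, ∀ (a : A) (n : ℕ), D ≤ n →
      (DirectSum.decompose 𝒜 (a * y) n : A) ∈ (irrelevant 𝒜).toIdeal * J) ?_ ?_ ?_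
  · rintro y z ⟨D, hD⟩ ⟨E, hE⟩
    refine ⟨max D E, fun a n hn => ?_⟩
    rw [mul_add, DirectSum.decompose_add, DirectSum.add_apply, Submodule.coe_add]
    exact Ideal.add_mem _ (hD a n (le_of_max_le_left hn)) (hE a n (le_of_max_le_right hn))
  · exact ⟨0, by simp⟩
  · intro e _
    refine ⟨e + 1, fun a n hn => ?_⟩
    rw [DirectSum.coe_decompose_mul_of_right_mem_of_le 𝒜 (SetLike.coe_mem _) (by omega)]
    exact Ideal.mul_mem_mul (mem_irrelevant_of_mem 𝒜 (by omega : 0 < n - e) (SetLike.coe_mem _))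
      (hJ e hy)

theorem Ideal.IsHomogeneous.exists_mem_irrelevant_mul {J : Ideal A} (hJ : J.IsHomogeneous 𝒜)
    (hfg : J.FG) :
    ∃ D : ℕ, ∀ n, D ≤ n → ∀ x ∈ 𝒜 n, x ∈ J → x ∈ (irrelevant 𝒜).toIdeal * J := by
  classical
  obtain ⟨s, hs⟩ := hfg
  have key : ∀ s : Finset A, (∀ y ∈ s, y ∈ J) → ∃ D : ℕ, ∀ x ∈ Ideal.span (s : Set A),
      ∀ n, D ≤ n → (DirectSum.decompose 𝒜 x n : A) ∈ (irrelevant 𝒜).toIdeal * J := by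
    intro s
    induction s using Finset.induction_on with
    | empty =>
      intro _
      refine ⟨0, fun x hx n _ => ?_⟩
      have : x = 0 := by simpa using hx
      simp [this]
    | insert y s _ ih =>
      intro hs
      obtain ⟨D, hD⟩ := ih fun z hz => hs z (Finset.mem_insert_of_mem hz)
      obtain ⟨E, hE⟩ := hJ.exists_decompose_mul_mem 𝒜 (hs y (Finset.mem_insert_self _ _))
      refine ⟨max D E, fun x hx n hn => ?_⟩
      rw [Finset.coe_insert, Ideal.mem_span_insert] at hx
      obtain ⟨a, z, hz, rfl⟩ := hx
      rw [DirectSum.decompose_add, DirectSum.add_apply, Submodule.coe_add]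
      exact Ideal.add_mem _ (hE a n (le_of_max_le_right hn)) (hD z hz n (le_of_max_le_left hn))
  obtain ⟨D, hD⟩ := key s fun y hy => hs ▸ Ideal.subset_span hy
  refine ⟨D, fun n hn x hx hxJ => ?_⟩
  have := hD x (hs.symm ▸ hxJ) n hn
  rwa [DirectSum.decompose_of_mem_same 𝒜 hx] at this

theorem Ideal.IsHomogeneous.exists_mem_irrelevant_pow_mul [IsNoetherianRing A] {J : Ideal A}
    (hJ : J.IsHomogeneous 𝒜) (N : ℕ) :
    ∃ D : ℕ, ∀ n, D ≤ n → ∀ x ∈ 𝒜 n, x ∈ J → x ∈ (irrelevant 𝒜).toIdeal ^ N * J := by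
  have hom : ∀ N : ℕ, ((irrelevant 𝒜).toIdeal ^ N * J).IsHomogeneous 𝒜 := by
    intro N
    induction N with
    | zero => simpa using hJ
    | succ N ih =>
      rw [pow_succ', mul_assoc]
      exact (irrelevant 𝒜).isHomogeneous.mul ih
  induction N with
  | zero => exact ⟨0, fun n _ x _ hx => by simpa using hx⟩
  | succ N ih =>
    obtain ⟨D, hD⟩ := ih
    obtain ⟨E, hE⟩ := (hom N).exists_mem_irrelevant_mul 𝒜 (IsNoetherian.noetherian _)
    refine ⟨max D E, fun n hn x hx hxJ => ?_⟩
    rw [pow_succ', mul_assoc]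
    exact hE n (le_of_max_le_right hn) x hx (hD n (le_of_max_le_left hn) x hx hxJ)

theorem isHomogeneous_colon_singleton {I : Ideal A} (hI : I.IsHomogeneous 𝒜) {h : A} {d : ℕ}
    (hh : h ∈ 𝒜 d) : (Submodule.colon I {h}).IsHomogeneous 𝒜 := by
  intro n y hy
  rw [Submodule.mem_colon_singleton, smul_eq_mul] at hy ⊢
  rw [← DirectSum.coe_decompose_mul_add_of_right_mem 𝒜 hh]
  exact hI _ hy

/-- The annihilator of a homogeneous `h` modulo a homogeneous `I` has bounded degree if and only
if it is torsion with respect to every homogeneous element of positive degree. -/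
theorem bounded_annihilator_iff [IsNoetherianRing A] {I : Ideal A} (hI : I.IsHomogeneous 𝒜)
    {h : A} {d : ℕ} (hh : h ∈ 𝒜 d) :
    (∃ N : ℕ, ∀ n : ℕ, N ≤ n → ∀ x ∈ 𝒜 n, x * h ∈ I → x ∈ I) ↔
      ∀ e, 0 < e → ∀ w ∈ 𝒜 e, ∀ y, y * h ∈ I → ∃ N, w ^ N * y ∈ I := by
  classical
  have hJ := isHomogeneous_colon_singleton 𝒜 hI hh
  constructor
  · rintro ⟨N, hN⟩ e he w hw y hy
    refine ⟨N, ?_⟩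
    rw [← DirectSum.sum_support_decompose 𝒜 y, Finset.mul_sum]
    refine Ideal.sum_mem _ fun n _ => hN (N • e + n) ?_ _
      (SetLike.mul_mem_graded (SetLike.pow_mem_graded N hw) (SetLike.coe_mem _)) ?_
    · rw [smul_eq_mul]
      nlinarith
    · rw [mul_assoc]
      refine Ideal.mul_mem_left _ _ ?_
      exact Submodule.mem_colon_singleton.1 (hJ n (Submodule.mem_colon_singleton.2 hy))
  · intro H
    obtain ⟨s, hs⟩ := IsNoetherian.noetherian (Submodule.colon I {h})
    have hrad : (irrelevant 𝒜).toIdeal ≤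
        (Submodule.colon I (Submodule.colon I {h} : Set A)).radical := by
      rw [irrelevant_eq_span, Ideal.span_le]
      intro w hw
      simp only [Set.mem_iUnion] at hw
      obtain ⟨e, he, hw⟩ := hw
      have hM : ∀ y ∈ s, ∃ N, w ^ N * y ∈ I := fun y hy =>
        H e he w hw y (Submodule.mem_colon_singleton.1 (hs ▸ Submodule.subset_span hy))
      choose! M hM using hM
      refine ⟨s.sup M, Submodule.mem_colon.2 ?_⟩
      intro y hy
      have hle : Submodule.colon I {h} ≤
          Submodule.colon I {w ^ s.sup M} := by
        rw [← hs, Submodule.span_le]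
        intro z hz
        refine Submodule.mem_colon_singleton.2 ?_
        rw [smul_eq_mul, mul_comm, ← Nat.sub_add_cancel (Finset.le_sup (f := M) hz), pow_add,
          mul_assoc]
        exact Ideal.mul_mem_left _ _ (hM z hz)
      have := Submodule.mem_colon_singleton.1 (hle hy)
      rwa [smul_eq_mul, mul_comm] at this
    obtain ⟨N, hN⟩ := Ideal.exists_pow_le_of_le_radical_of_fg hrad (IsNoetherian.noetherian _)
    obtain ⟨D, hD⟩ := hJ.exists_mem_irrelevant_pow_mul 𝒜 N
    refine ⟨D, fun n hn x hx hxh => ?_⟩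
    have hle : (irrelevant 𝒜).toIdeal ^ N * Submodule.colon I {h} ≤ I :=
      Ideal.mul_le.2 fun a ha b hb => Submodule.mem_colon.1 (hN ha) b hb
    exact hle (hD n hn x hx (Submodule.mem_colon_singleton.2 hxh))

theorem filterRegular_iff_weaklyRegularSeq_away [IsNoetherianRing A] {r : ℕ} {h : Fin r → A}
    (hh : ∀ i, ∃ d, h i ∈ 𝒜 d) :
    FilterRegular 𝒜 h ↔ ∀ e, 0 < e → ∀ w ∈ 𝒜 e,
      WeaklyRegularSeq (fun i => algebraMap A (Localization.Away w) (h i)) := by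
  have hI : ∀ i : Fin r, (Ideal.span (h '' {j | j < i})).IsHomogeneous 𝒜 := by
    intro i
    refine Ideal.homogeneous_span 𝒜 _ ?_
    rintro _ ⟨j, _, rfl⟩
    exact hh j
  simp only [weaklyRegularSeq_away_iff]
  constructor
  · intro H e he w hw i
    obtain ⟨d, hd⟩ := hh i
    exact (bounded_annihilator_iff 𝒜 (hI i) hd).1 (H i) e he w hw
  · intro H i
    obtain ⟨d, hd⟩ := hh i
    exact (bounded_annihilator_iff 𝒜 (hI i) hd).2 fun e he w hw => H e he w hw i

theorem filterRegular_pow_iff [IsNoetherianRing A] {r : ℕ} {h : Fin r → A}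
    (hh : ∀ i, ∃ d, h i ∈ 𝒜 d) {n : ℕ} (hn : 0 < n) :
    FilterRegular 𝒜 (fun i => h i ^ n) ↔ FilterRegular 𝒜 h := by
  have hh' : ∀ i, ∃ d, h i ^ n ∈ 𝒜 d := fun i =>
    let ⟨d, hd⟩ := hh i
    ⟨n • d, SetLike.pow_mem_graded n hd⟩
  rw [filterRegular_iff_weaklyRegularSeq_away 𝒜 hh,
    filterRegular_iff_weaklyRegularSeq_away 𝒜 hh']
  simp only [map_pow, weaklyRegularSeq_pow_iff _ hn]

end Graded

theorem exists_pow_eq_pow_of_isNilpotent_sub {A ι : Type*} [CommRing A] [Finite ι] (q : ℕ)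
    [Fact q.Prime] [CharP A q] {f g : ι → A} (hnil : ∀ i, IsNilpotent (g i - f i)) :
    ∃ n, 0 < n ∧ ∀ i, f i ^ n = g i ^ n := by
  cases nonempty_fintype ι
  choose N hN using hnil
  have hq := (Fact.out : q.Prime)
  refine ⟨q ^ Finset.univ.sup N, pow_pos hq.pos _, fun i => ?_⟩
  rw [eq_comm, ← sub_eq_zero, ← sub_pow_char_pow]
  refine pow_eq_zero_of_le ?_ (hN i)
  exact (Finset.le_sup (Finset.mem_univ i)).trans (Nat.lt_pow_self hq.one_lt).le

theorem stmt4 {k A : Type*} [Field k] [CommRing A] [Algebra k A]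
    (q : ℕ) (hq : 0 < q) [CharP k q]
    (𝒜 : ℕ → Submodule k A) [GradedAlgebra 𝒜]
    (hconn : 𝒜 0 = 1) [Algebra.FiniteType k A]
    {r : ℕ} (f g : Fin r → A)
    (hfpos : ∀ i, ∃ n, 0 < n ∧ f i ∈ 𝒜 n)
    (hgpos : ∀ i, ∃ n, 0 < n ∧ g i ∈ 𝒜 n)
    (hnil : ∀ i, IsNilpotent (g i - f i)) :
    FilterRegular 𝒜 f ↔ FilterRegular 𝒜 g := by
  have : IsNoetherianRing A := Algebra.FiniteType.isNoetherianRing k A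
  cases subsingleton_or_nontrivial A with
  | inl _ => rw [Subsingleton.elim f g]
  | inr _ =>
    have : NeZero q := ⟨hq.ne'⟩
    have : Fact q.Prime := CharP.char_is_prime_of_pos k q
    have : CharP A q := charP_of_injective_algebraMap (algebraMap k A).injective q
    obtain ⟨n, hn, hfg⟩ := exists_pow_eq_pow_of_isNilpotent_sub q hnil
    rw [← filterRegular_pow_iff 𝒜 (fun i => (hfpos i).imp fun _ h => h.2) hn,
      ← filterRegular_pow_iff 𝒜 (fun i => (hgpos i).imp fun _ h => h.2) hn]
    simp only [hfg]
end

section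
/- Let d ≥ 1 and suppose that A is a finitely generated module over A(d), the k-subalgebra of A generated by the degree-d component A_d. Then there exist a finite field extension L of k and an element x of the degree-d component of A_L = L ⊗_k A such that the annihilator of x in A_L is a finite-dimensional L-vector space. -/
open scoped TensorProduct
set_option synthInstance.maxHeartbeats 1000000
set_option maxHeartbeats 1000000

/-- Over an infinite field, a subspace `V` of a noetherian algebra contains an element `x` such that
every element of `V` acts nilpotently on the annihilator of `x`. -/
theorem exists_mem_forall_pow_mul_eq_zero {K B : Type*} [Field K] [Infinite K] [CommRing B]
    [Algebra K B] [IsNoetherianRing B] (V : Submodule K B) :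
    ∃ x ∈ V, ∀ v ∈ V, ∃ m : ℕ, ∀ y : B, y * x = 0 → v ^ m * y = 0 := by
  have : Finite (associatedPrimes B B) := associatedPrimes.finite B B
  let S := {P : associatedPrimes B B // ¬ V ≤ P.1.restrictScalars K}
  let W : S → Subspace K V := fun P ↦ (P.1.1.restrictScalars K).comap V.subtype
  obtain ⟨x, hx⟩ : ∃ x : V, ∀ P : S, (x : B) ∉ P.1.1 := by
    by_contra! h
    obtain ⟨P, hP⟩ := Subspace.exists_eq_top_of_iUnion_eq_univ (p := W) <|
      Set.eq_univ_of_forall fun x ↦ Set.mem_iUnion.2 (h x)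
    exact P.2 (Submodule.comap_subtype_eq_top.1 hP)
  refine ⟨x, x.2, fun v hv ↦ ?_⟩
  let N : Ideal B := LinearMap.ker (LinearMap.toSpanSingleton B B (x : B))
  have hrad : v ∈ (Module.annihilator B N).radical := by
    rw [← Ideal.sInf_minimalPrimes, Ideal.mem_sInf]
    intro P hP
    have hPN := Module.associatedPrimes.minimalPrimes_annihilator_subset_associatedPrimes B N hP
    have hPB : P ∈ associatedPrimes B B :=
      associatedPrimes.subset_of_injective N.injective_subtype hPN
    obtain ⟨y, hy⟩ := ((isAssociatedPrime_iff).1 hPN).2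
    have hxP : (x : B) ∈ P := by
      rw [hy, Submodule.mem_colon_singleton, Submodule.mem_bot]
      ext
      have : (y : B) * x = 0 := y.2
      simpa [mul_comm] using this
    by_contra hvP
    exact hx ⟨⟨P, hPB⟩, fun h ↦ hvP (h hv)⟩ hxP
  obtain ⟨m, hm⟩ := hrad
  refine ⟨m, fun y hy ↦ ?_⟩
  exact congrArg Subtype.val (Module.mem_annihilator.1 hm (⟨y, hy⟩ : N))

theorem Module.finite_ideal_of_isIntegral_quotient_annihilator {F B : Type*} [Field F] [CommRing B]
    [Algebra F B] [Algebra.FiniteType F B] (N : Ideal B)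
    [Algebra.IsIntegral F (B ⧸ Module.annihilator B N)] : Module.Finite F N := by
  have : IsNoetherianRing B := Algebra.FiniteType.isNoetherianRing F B
  let I := Module.annihilator B N
  have : Module.Finite F (B ⧸ I) := Algebra.IsIntegral.finite
  let : Module (B ⧸ I) N := Module.quotientAnnihilator
  have : IsScalarTower B (B ⧸ I) N := .of_algebraMap_smul fun _ _ ↦ rfl
  have : IsScalarTower F (B ⧸ I) N := .of_algebraMap_smul fun r n ↦ by
    rw [IsScalarTower.algebraMap_apply F B (B ⧸ I), algebraMap_smul, algebraMap_smul]
  have : Module.Finite (B ⧸ I) N := .of_restrictScalars_finite B _ _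
  exact .trans (B ⧸ I) N

/-- If `A` is integral over the subalgebra generated by `S` and an algebra map sends `S` to integral
elements, then it sends every element to an integral element. -/
theorem AlgHom.isIntegral_apply_of_isIntegral_adjoin {k A C : Type*} [CommRing k] [CommRing A]
    [CommRing C] [Algebra k A] [Algebra k C] (φ : A →ₐ[k] C) {S : Set A}
    [Algebra.IsIntegral (Algebra.adjoin k S) A] (hS : ∀ s ∈ S, IsIntegral k (φ s)) (a : A) :
    IsIntegral k (φ a) := by
  have hmap : (Algebra.adjoin k S).map φ ≤ integralClosure k C := by
    rw [AlgHom.map_adjoin, Algebra.adjoin_le_iff]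
    rintro _ ⟨s, hs, rfl⟩
    exact hS s hs
  let ψ : Algebra.adjoin k S →ₐ[k] integralClosure k C :=
    (φ.comp (Algebra.adjoin k S).val).codRestrict _ fun s ↦ hmap ⟨s, s.2, rfl⟩
  obtain ⟨f, hf, hfa⟩ := Algebra.IsIntegral.isIntegral (R := Algebra.adjoin k S) a
  have : IsIntegral (integralClosure k C) (φ a) := by
    refine ⟨f.map ψ.toRingHom, hf.map _, ?_⟩
    rw [Polynomial.eval₂_map]
    have h := congrArg φ hfa
    rw [map_zero, ← AlgHom.coe_toRingHom, Polynomial.hom_eval₂] at h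
    exact h
  exact isIntegral_trans _ this

theorem Submodule.exists_finiteDimensional_mem_baseChange {k K M : Type*} [Field k] [Field K]
    [Algebra k K] [Algebra.IsAlgebraic k K] [AddCommGroup M] [Module k M] (V : Submodule k M)
    {x : K ⊗[k] M} (hx : x ∈ V.baseChange K) :
    ∃ L : IntermediateField k K, FiniteDimensional k L ∧
      ∃ y ∈ V.baseChange L, L.val.toLinearMap.rTensor M y = x := by
  rw [Submodule.baseChange_eq_span] at hx
  obtain ⟨n, c, g, rfl⟩ := Submodule.mem_span_set'.1 hx
  choose v hv hvg using fun i ↦ (g i).2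
  refine ⟨IntermediateField.adjoin k (Set.range c),
    IntermediateField.finiteDimensional_adjoin fun z _ ↦ Algebra.IsIntegral.isIntegral z,
    ∑ i, (⟨c i, IntermediateField.subset_adjoin _ _ ⟨i, rfl⟩⟩ :
      IntermediateField.adjoin k (Set.range c)) ⊗ₜ[k] v i,
    Submodule.sum_mem _ fun i _ ↦ Submodule.tmul_mem_baseChange_of_mem _ (hv i), ?_⟩
  rw [map_sum]
  refine Finset.sum_congr rfl fun i _ ↦ ?_
  rw [← hvg i]
  simp [TensorProduct.smul_tmul']

/-- If `A` is integral over the subalgebra generated by `S` and every element of `S` acts nilpotently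
on the annihilator of `y` in `L ⊗[k] A`, then this annihilator is finite-dimensional. -/
theorem LinearMap.finite_ker_mulRight_of_forall_pow_mul_eq_zero {k L A : Type*} [Field k] [Field L]
    [Algebra k L] [CommRing A] [Algebra k A] [Algebra.FiniteType k A] (S : Set A)
    [Algebra.IsIntegral (Algebra.adjoin k S) A] (y : L ⊗[k] A)
    (hS : ∀ a ∈ S, ∃ m : ℕ, ∀ z : L ⊗[k] A, z * y = 0 → ((1 : L) ⊗ₜ[k] a) ^ m * z = 0) :
    Module.Finite L (LinearMap.ker (LinearMap.mulRight L y)) := by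
  let N : Ideal (L ⊗[k] A) := LinearMap.ker (LinearMap.toSpanSingleton (L ⊗[k] A) (L ⊗[k] A) y)
  let π : L ⊗[k] A →ₐ[L] (L ⊗[k] A) ⧸ Module.annihilator (L ⊗[k] A) N := Ideal.Quotient.mkₐ L _
  let φ : A →ₐ[k] (L ⊗[k] A) ⧸ Module.annihilator (L ⊗[k] A) N :=
    (π.restrictScalars k).comp Algebra.TensorProduct.includeRight
  have hφ : ∀ a ∈ S, IsIntegral k (φ a) := by
    intro a ha
    obtain ⟨m, hm⟩ := hS a ha
    have hmem : ((1 : L) ⊗ₜ[k] a) ^ m ∈ Module.annihilator (L ⊗[k] A) N :=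
      Module.mem_annihilator.2 fun n ↦ Subtype.ext (hm n n.2)
    have hzero : φ a ^ m = 0 := by
      have h : π (((1 : L) ⊗ₜ[k] a) ^ m) = 0 := Ideal.Quotient.eq_zero_iff_mem.2 hmem
      rwa [map_pow] at h
    exact ⟨Polynomial.X ^ m, Polynomial.monic_X_pow m, by simpa using hzero⟩
  have : Algebra.IsIntegral L ((L ⊗[k] A) ⧸ Module.annihilator (L ⊗[k] A) N) := by
    refine ⟨fun z ↦ ?_⟩
    obtain ⟨z, rfl⟩ := Ideal.Quotient.mk_surjective z
    induction z using TensorProduct.induction_on with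
    | zero => simpa using isIntegral_zero
    | add u v hu hv => simpa using hu.add hv
    | tmul l a =>
      have h : IsIntegral L (φ a) := (φ.isIntegral_apply_of_isIntegral_adjoin hφ a).tower_top
      have h' : Ideal.Quotient.mk (Module.annihilator (L ⊗[k] A) N) (l ⊗ₜ a) = l • φ a := by
        change π (l ⊗ₜ a) = l • π (1 ⊗ₜ a)
        rw [← map_smul, TensorProduct.smul_tmul', smul_eq_mul, mul_one]
      rw [h']
      exact h.smul l
  exact Module.finite_ideal_of_isIntegral_quotient_annihilator (F := L) N

theorem stmt5 {k A : Type*} [Field k] [CommRing A] [Algebra k A]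
    (q : ℕ) (hq : 0 < q) [CharP k q]
    (𝒜 : ℕ → Submodule k A) [GradedAlgebra 𝒜]
    (hconn : 𝒜 0 = 1) [Algebra.FiniteType k A]
    (d : ℕ) (hd : 1 ≤ d)
    (hfin : Module.Finite ↥(Algebra.adjoin k ((𝒜 d : Set A))) A) :
    ∃ L : IntermediateField k (AlgebraicClosure k),
      FiniteDimensional k ↥L ∧
      ∃ x ∈ (𝒜 d).baseChange ↥L,
        FiniteDimensional ↥L ↥(LinearMap.ker (LinearMap.mulRight ↥L x)) := by
  let K := AlgebraicClosure k
  have : IsNoetherianRing (K ⊗[k] A) := Algebra.FiniteType.isNoetherianRing K _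
  obtain ⟨x, hx, hnil⟩ := exists_mem_forall_pow_mul_eq_zero ((𝒜 d).baseChange K)
  obtain ⟨L, hL, y, hy, rfl⟩ := (𝒜 d).exists_finiteDimensional_mem_baseChange hx
  refine ⟨L, hL, y, hy, ?_⟩
  let ι : L ⊗[k] A →ₐ[k] K ⊗[k] A := Algebra.TensorProduct.map L.val (AlgHom.id k A)
  have hι : Function.Injective ι :=
    Module.Flat.rTensor_preserves_injective_linearMap (M := A) L.val.toLinearMap L.val.injective
  have : Algebra.IsIntegral (Algebra.adjoin k (𝒜 d : Set A)) A := Algebra.IsIntegral.of_finite _ _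
  refine LinearMap.finite_ker_mulRight_of_forall_pow_mul_eq_zero (𝒜 d : Set A) y fun a ha ↦ ?_
  obtain ⟨m, hm⟩ := hnil (1 ⊗ₜ a) (Submodule.tmul_mem_baseChange_of_mem _ ha)
  refine ⟨m, fun z hz ↦ hι ?_⟩
  have h := hm (ι z) ((map_mul ι _ _).symm.trans (by rw [hz, map_zero]))
  simpa [ι] using h
end

section
/- Let y_1, ..., y_r be homogeneous elements of A_+ such that A is a finitely generated module over the subalgebra K[y_1, ..., y_r] they generate. If 𝔭 is an associated prime of A (as a module over itself) that contains y_1, ..., y_r, then 𝔭 equals the irrelevant ideal A_+. -/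
/-- An element of the subalgebra generated by a subset of an ideal is congruent to a scalar. -/
theorem Ideal.exists_sub_algebraMap_mem_of_mem_adjoin {K A : Type*} [CommRing K] [CommRing A]
    [Algebra K A] {s : Set A} {I : Ideal A} (hs : s ⊆ I) {x : A} (hx : x ∈ Algebra.adjoin K s) :
    ∃ c : K, x - algebraMap K A c ∈ I := by
  induction hx using Algebra.adjoin_induction with
  | mem x hx => exact ⟨0, by simpa using hs hx⟩
  | algebraMap c => exact ⟨c, by simp⟩
  | add x y _ _ hx hy =>
    obtain ⟨c, hc⟩ := hx
    obtain ⟨d, hd⟩ := hy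
    refine ⟨c + d, ?_⟩
    rw [map_add, add_sub_add_comm]
    exact I.add_mem hc hd
  | mul x y _ _ hx hy =>
    obtain ⟨c, hc⟩ := hx
    obtain ⟨d, hd⟩ := hy
    refine ⟨c * d, ?_⟩
    have h := I.add_mem (I.mul_mem_left y hc) (I.mul_mem_left (algebraMap K A c) hd)
    convert h using 1
    rw [map_mul]
    ring

/-- A prime ideal containing generators of a subalgebra over which the ring is integral
is maximal. -/
theorem Ideal.IsPrime.isMaximal_of_isIntegral_adjoin {K A : Type*} [Field K] [CommRing A]
    [Algebra K A] {s : Set A} [Algebra.IsIntegral (Algebra.adjoin K s) A] {P : Ideal A}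
    (hP : P.IsPrime) (hs : s ⊆ P) : P.IsMaximal := by
  refine Ideal.isMaximal_of_isIntegral_of_isMaximal_comap (R := Algebra.adjoin K s) P ?_
  refine Ideal.isMaximal_iff.2 ⟨fun h ↦ hP.ne_top ((Ideal.eq_top_iff_one P).2 ?_), ?_⟩
  · simpa using h
  · intro J x hJ hx hxJ
    obtain ⟨c, hc⟩ := Ideal.exists_sub_algebraMap_mem_of_mem_adjoin hs x.2
    have hc0 : c ≠ 0 := by
      rintro rfl
      exact hx (by simpa using hc)
    have hcJ : algebraMap K (Algebra.adjoin K s) c ∈ J := by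
      have h : x - algebraMap K (Algebra.adjoin K s) c ∈ J := hJ hc
      simpa using J.sub_mem hxJ h
    have h := J.mul_mem_left (algebraMap K (Algebra.adjoin K s) c⁻¹) hcJ
    rwa [← map_mul, inv_mul_cancel₀ hc0, map_one] at h

/-- In a connected graded algebra over a field, proper homogeneous ideals lie in the
irrelevant ideal. -/
theorem Ideal.IsHomogeneous.le_irrelevant {K A : Type*} [Field K] [CommRing A] [Algebra K A]
    {𝒜 : ℕ → Submodule K A} [GradedAlgebra 𝒜] (hconn : 𝒜 0 = 1) {I : Ideal A}
    (hI : I.IsHomogeneous 𝒜) (hne : I ≠ ⊤) :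
    I ≤ (HomogeneousIdeal.irrelevant 𝒜).toIdeal := by
  intro x hx
  change x ∈ HomogeneousIdeal.irrelevant 𝒜
  rw [HomogeneousIdeal.mem_irrelevant_iff, GradedRing.proj_apply]
  have h0 : (DirectSum.decompose 𝒜 x 0 : A) ∈ I := hI 0 hx
  have h1 : (DirectSum.decompose 𝒜 x 0 : A) ∈ (1 : Submodule K A) := hconn ▸ SetLike.coe_mem _
  obtain ⟨c, hc⟩ := Submodule.mem_one.1 h1
  rw [← hc] at h0 ⊢
  by_contra hne0
  have hc0 : c ≠ 0 := by
    rintro rfl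
    exact hne0 (map_zero _)
  exact hne (Ideal.eq_top_of_isUnit_mem I h0 ((IsUnit.mk0 c hc0).map (algebraMap K A)))

theorem stmt7 {K A : Type*} [Field K] [CommRing A] [Algebra K A]
    (𝒜 : ℕ → Submodule K A) [GradedAlgebra 𝒜]
    (hconn : 𝒜 0 = 1) [Algebra.FiniteType K A]
    {r : ℕ} (y : Fin r → A) (hpos : ∀ i, ∃ n, 0 < n ∧ y i ∈ 𝒜 n)
    (hfin : Module.Finite ↥(Algebra.adjoin K (Set.range y)) A)
    (𝔭 : Ideal A) (hass : IsAssociatedPrime 𝔭 A)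
    (hcont : ∀ i, y i ∈ 𝔭) :
    𝔭 = (HomogeneousIdeal.irrelevant 𝒜).toIdeal := by
  have hp : 𝔭.IsPrime := hass.1
  have : Nontrivial A := ⟨0, 1, fun h ↦ hp.ne_top ((Ideal.eq_top_iff_one 𝔭).2 (h ▸ 𝔭.zero_mem))⟩
  have : Algebra.IsIntegral (Algebra.adjoin K (Set.range y)) A := Algebra.IsIntegral.of_finite _ _
  have hq : (𝔭.homogeneousCore 𝒜).toIdeal.IsPrime := hp.homogeneousCore
  have hy : Set.range y ⊆ (𝔭.homogeneousCore 𝒜).toIdeal := by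
    rintro _ ⟨i, rfl⟩
    obtain ⟨n, -, hn⟩ := hpos i
    exact Ideal.mem_homogeneousCore_of_homogeneous_of_mem ⟨n, hn⟩ (hcont i)
  have hmax := hq.isMaximal_of_isIntegral_adjoin (K := K) hy
  have hcore : (𝔭.homogeneousCore 𝒜).toIdeal = 𝔭 :=
    hmax.eq_of_le hp.ne_top (Ideal.toIdeal_homogeneousCore_le 𝒜 𝔭)
  have hirr : (HomogeneousIdeal.irrelevant 𝒜).toIdeal ≠ ⊤ := by
    intro h
    have h1 : (1 : A) ∈ HomogeneousIdeal.irrelevant 𝒜 := (Ideal.eq_top_iff_one _).1 h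
    rw [HomogeneousIdeal.mem_irrelevant_iff, GradedRing.proj_apply,
      DirectSum.decompose_of_mem_same 𝒜 SetLike.GradedOne.one_mem] at h1
    exact one_ne_zero h1
  rw [← hcore]
  exact hmax.eq_of_le hirr
    (Ideal.IsHomogeneous.le_irrelevant hconn (𝔭.homogeneousCore 𝒜).isHomogeneous hq.ne_top)
end

section
/- Let x be a homogeneous element of A such that x does not lie in any associated prime of A other than possibly the irrelevant ideal A_+. Then the annihilator Ann_A(x) is a finite-dimensional K-vector space. -/
/-- A finitely generated module over a finitely generated algebra is finite-dimensional over the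
base field as soon as its associated primes are all maximal. -/
theorem Module.finite_of_isAssociatedPrime_isMaximal (K : Type*) {A M : Type*} [Field K]
    [CommRing A] [Algebra K A] [Algebra.FiniteType K A] [AddCommGroup M] [Module A M] [Module K M]
    [IsScalarTower K A M] [Module.Finite A M]
    (h : ∀ 𝔭 : Ideal A, IsAssociatedPrime 𝔭 M → 𝔭.IsMaximal) : Module.Finite K M := by
  have : IsNoetherianRing A := Algebra.FiniteType.isNoetherianRing K A
  have : Ring.KrullDimLE 0 (A ⧸ Module.annihilator A M) :=
    Ideal.krullDimLE_zero_quotient_iff_forall_minimalPrimes_isMaximal.mpr fun 𝔭 h𝔭 ↦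
      h 𝔭 (Module.associatedPrimes.minimalPrimes_annihilator_subset_associatedPrimes A M h𝔭)
  have : IsArtinianRing (A ⧸ Module.annihilator A M) :=
    isArtinianRing_iff_krullDimLE_zero.mpr this
  have : Module.Finite K (A ⧸ Module.annihilator A M) := Module.finite_of_isArtinianRing K _
  let _ : Module (A ⧸ Module.annihilator A M) M := Module.quotientAnnihilator
  have : IsScalarTower A (A ⧸ Module.annihilator A M) M :=
    Module.IsTorsionBySet.isScalarTower _
  have : IsScalarTower K (A ⧸ Module.annihilator A M) M :=
    Module.IsTorsionBySet.isScalarTower _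
  have : Module.Finite (A ⧸ Module.annihilator A M) M :=
    Module.Finite.of_restrictScalars_finite A _ M
  exact Module.Finite.trans (A ⧸ Module.annihilator A M) M

/-- The irrelevant ideal of a connected graded algebra over a field is maximal. -/
theorem HomogeneousIdeal.isMaximal_toIdeal_irrelevant {K A : Type*} [Field K] [CommRing A]
    [Nontrivial A] [Algebra K A] (𝒜 : ℕ → Submodule K A) [GradedAlgebra 𝒜] (hconn : 𝒜 0 = 1) :
    (HomogeneousIdeal.irrelevant 𝒜).toIdeal.IsMaximal := by
  refine Ideal.isMaximal_iff.mpr ⟨fun h ↦ ?_, fun J a hJ ha haJ ↦ ?_⟩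
  · have h0 : GradedRing.proj 𝒜 0 1 = 0 := h
    rw [GradedRing.proj_apply, DirectSum.decompose_of_mem_same 𝒜 SetLike.GradedOne.one_mem] at h0
    exact one_ne_zero h0
  · have hmem : GradedRing.proj 𝒜 0 a ∈ 𝒜 0 := by
      rw [GradedRing.proj_apply]
      exact SetLike.coe_mem _
    have hsub : a - GradedRing.proj 𝒜 0 a ∈ (HomogeneousIdeal.irrelevant 𝒜).toIdeal := by
      change GradedRing.proj 𝒜 0 (a - GradedRing.proj 𝒜 0 a) = 0
      rw [map_sub, GradedRing.proj_apply 𝒜 0 (GradedRing.proj 𝒜 0 a),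
        DirectSum.decompose_of_mem_same 𝒜 hmem, sub_self]
    rw [hconn] at hmem
    obtain ⟨c, hc⟩ := Submodule.mem_one.mp hmem
    have hc0 : c ≠ 0 := by
      rintro rfl
      exact ha (by simpa using hc.symm)
    have hcJ : algebraMap K A c ∈ J := by
      rw [hc]
      simpa using J.sub_mem haJ (hJ hsub)
    rw [← Ideal.eq_top_iff_one]
    exact J.eq_top_of_isUnit_mem hcJ ((IsUnit.mk0 c hc0).map _)

theorem stmt8 {K A : Type*} [Field K] [CommRing A] [Algebra K A]
    (𝒜 : ℕ → Submodule K A) [GradedAlgebra 𝒜]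
    (hconn : 𝒜 0 = 1) [Algebra.FiniteType K A]
    (x : A) (hx : ∃ n, x ∈ 𝒜 n)
    (hass : ∀ 𝔭 : Ideal A, IsAssociatedPrime 𝔭 A →
      𝔭 ≠ (HomogeneousIdeal.irrelevant 𝒜).toIdeal → x ∉ 𝔭) :
    FiniteDimensional K ↥(LinearMap.ker (LinearMap.mulRight K x)) := by
  have : IsNoetherianRing A := Algebra.FiniteType.isNoetherianRing K A
  let N : Ideal A := LinearMap.ker (LinearMap.mulRight A x)
  change Module.Finite K N
  refine Module.finite_of_isAssociatedPrime_isMaximal K (A := A) fun 𝔭 h𝔭 ↦ ?_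
  have hx𝔭 : x ∈ 𝔭 := by
    refine h𝔭.annihilator_le (Submodule.mem_annihilator.mpr fun y _ ↦ Subtype.ext ?_)
    have hy : (y : A) * x = 0 := y.2
    simpa [mul_comm] using hy
  have h𝔭A : IsAssociatedPrime 𝔭 A := h𝔭.map_of_injective N.subtype N.injective_subtype
  have : Nontrivial A := by
    by_contra hA
    rw [not_nontrivial_iff_subsingleton] at hA
    exact not_isAssociatedPrime_of_subsingleton h𝔭A
  rw [not_imp_comm.mp (hass 𝔭 h𝔭A) (not_not.mpr hx𝔭)]
  exact HomogeneousIdeal.isMaximal_toIdeal_irrelevant 𝒜 hconn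
end

section
/- Let G be a finite group and p a prime. If δ₀(G) ≥ 3, then p^5 divides the order of G; and if moreover p = 2 or p = 3, then p^6 divides the order of G. -/
/-- The `p`-rank of a group `G`: the largest `r` such that `G` contains an
elementary abelian `p`-subgroup of rank `r`, i.e. a subgroup isomorphic to `(ℤ/pℤ)^r`. -/
noncomputable def prank (p : ℕ) (G : Type*) [Group G] : ℕ :=
  sSup {r : ℕ | ∃ H : Subgroup G, Nonempty (↥H ≃* Multiplicative (Fin r → ZMod p))}

section PRank

variable {p : ℕ} [Fact p.Prime]

theorem bddAbove_elementaryAbelian_rank (G : Type*) [Group G] [Finite G] :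
    BddAbove {r : ℕ | ∃ H : Subgroup G, Nonempty (↥H ≃* Multiplicative (Fin r → ZMod p))} := by
  refine ⟨Nat.card G, ?_⟩
  rintro r ⟨H, ⟨e⟩⟩
  have hc : Nat.card H = p ^ r := by
    rw [Nat.card_congr e.toEquiv]
    simp
  exact (Nat.lt_pow_self (Fact.out : p.Prime).one_lt).le.trans
    (hc ▸ H.card_le_card_group)

theorem exists_injective_hom_prank (G : Type*) [Group G] [Finite G] :
    ∃ f : Multiplicative (Fin (prank p G) → ZMod p) →* G, Function.Injective f := by
  have hne : {r : ℕ | ∃ H : Subgroup G,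
      Nonempty (↥H ≃* Multiplicative (Fin r → ZMod p))}.Nonempty :=
    ⟨0, ⊥, ⟨MulEquiv.ofUnique⟩⟩
  obtain ⟨H, ⟨e⟩⟩ := Nat.sSup_mem hne (bddAbove_elementaryAbelian_rank G)
  exact ⟨H.subtype.comp e.symm.toMonoidHom, H.subtype_injective.comp e.symm.injective⟩

theorem finrank_le_prank_of_injective {G V : Type*} [Group G] [Finite G] [AddCommGroup V]
    [Module (ZMod p) V] [FiniteDimensional (ZMod p) V] (f : Multiplicative V →* G)
    (hf : Function.Injective f) : Module.finrank (ZMod p) V ≤ prank p G := by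
  refine le_csSup (bddAbove_elementaryAbelian_rank G) ⟨f.range, ⟨?_⟩⟩
  exact (MonoidHom.ofInjective hf).symm.trans
    (AddEquiv.toMultiplicative (Module.finBasis (ZMod p) V).equivFun.toAddEquiv)

theorem finrank_le_prank_center {P V : Type*} [Group P] [Finite P] [AddCommGroup V]
    [Module (ZMod p) V] [FiniteDimensional (ZMod p) V] (f : Multiplicative V →* P)
    (hf : Function.Injective f) (hc : ∀ v, f v ∈ Subgroup.center P) :
    Module.finrank (ZMod p) V ≤ prank p (Subgroup.center P) :=
  finrank_le_prank_of_injective (f.codRestrict (Subgroup.center P) hc)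
    ((MonoidHom.injective_codRestrict f _ hc).2 hf)

theorem one_le_prank_center {P : Type*} [Group P] [Finite P] [Nontrivial P]
    (hP : IsPGroup p P) : 1 ≤ prank p (Subgroup.center P) := by
  have := hP.center_nontrivial
  obtain ⟨n, hn0, hn⟩ := (hP.to_subgroup (Subgroup.center P)).nontrivial_iff_card.mp this
  obtain ⟨g, hg⟩ := exists_prime_orderOf_dvd_card' (G := Subgroup.center P) p
    (hn ▸ dvd_pow_self p hn0.ne')
  let e : Multiplicative (ZMod p) ≃* Subgroup.zpowers g :=
    mulEquivOfPrimeCardEq (p := p) (by simp) (by rw [Nat.card_zpowers, hg])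
  simpa using finrank_le_prank_of_injective (p := p)
    ((Subgroup.zpowers g).subtype.comp e.toMonoidHom)
    ((Subgroup.zpowers g).subtype_injective.comp e.injective)

end PRank

theorem LinearMap.finrank_ker_comp_le {K U V W : Type*} [Field K] [AddCommGroup U] [AddCommGroup V]
    [AddCommGroup W] [Module K U] [Module K V] [Module K W] [FiniteDimensional K U]
    [FiniteDimensional K V] (f : V →ₗ[K] W) (g : U →ₗ[K] V) :
    Module.finrank K (LinearMap.ker (f ∘ₗ g)) ≤
      Module.finrank K (LinearMap.ker f) + Module.finrank K (LinearMap.ker g) := by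
  let h : LinearMap.ker (f ∘ₗ g) →ₗ[K] LinearMap.ker f :=
    (g.domRestrict _).codRestrict _ fun x => x.2
  have hker : Module.finrank K (LinearMap.ker h) ≤ Module.finrank K (LinearMap.ker g) := by
    let i : LinearMap.ker h →ₗ[K] LinearMap.ker g :=
      ((Submodule.subtype _).domRestrict _).codRestrict _ fun x => congrArg Subtype.val x.2
    refine LinearMap.finrank_le_finrank_of_injective (f := i) fun x y hxy => ?_
    exact Subtype.ext (Subtype.ext (congrArg (fun z : LinearMap.ker g => (z : U)) hxy))
  have hrange := Submodule.finrank_le (LinearMap.range h)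
  have := h.finrank_range_add_finrank_ker
  omega

theorem LinearMap.finrank_ker_pow_le {K V : Type*} [Field K] [AddCommGroup V] [Module K V]
    [FiniteDimensional K V] (T : Module.End K V) (n : ℕ) :
    Module.finrank K (LinearMap.ker (T ^ n)) ≤ n * Module.finrank K (LinearMap.ker T) := by
  induction n with
  | zero => simp [Module.End.one_eq_id]
  | succ n ih =>
    rw [pow_succ, Module.End.mul_eq_comp, Nat.succ_mul]
    exact (LinearMap.finrank_ker_comp_le _ _).trans (by gcongr)

/-- An automorphism of order dividing `p` of an `𝔽_p`-vector space is unipotent with Jordan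
blocks of size at most `p`. -/
theorem finrank_le_mul_finrank_ker_sub_one {p : ℕ} [Fact p.Prime] {V : Type*} [AddCommGroup V]
    [Module (ZMod p) V] [FiniteDimensional (ZMod p) V] (φ : Module.End (ZMod p) V)
    (hφ : φ ^ p = 1) :
    Module.finrank (ZMod p) V ≤ p * Module.finrank (ZMod p) (LinearMap.ker (φ - 1)) := by
  rcases subsingleton_or_nontrivial V with hV | hV
  · simp [Module.finrank_zero_of_subsingleton]
  have : CharP (Module.End (ZMod p) V) p := charP_of_injective_algebraMap' (ZMod p) p
  have h : (φ - 1) ^ p = 0 := by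
    rw [sub_pow_expChar_of_commute p (Commute.one_right φ), hφ, one_pow, sub_self]
  have := LinearMap.finrank_ker_pow_le (φ - 1) p
  rwa [h, LinearMap.ker_zero, finrank_top] at this

theorem Subgroup.mem_center_of_commute_of_index_prime {P : Type*} [Group P] [Finite P]
    {A : Subgroup P} (hA : A.index.Prime) {x w : P} (hx : x ∉ A) (hxw : Commute x w)
    (hAw : ∀ a ∈ A, Commute a w) : w ∈ Subgroup.center P := by
  have hle : A ≤ Subgroup.centralizer {w} := fun a ha =>
    Subgroup.mem_centralizer_singleton_iff.2 (hAw a ha).eq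
  have hxC : x ∈ Subgroup.centralizer {w} := Subgroup.mem_centralizer_singleton_iff.2 hxw.eq
  have hlt : A < Subgroup.centralizer {w} := lt_of_le_of_ne hle fun h => hx (h ▸ hxC)
  have htop : Subgroup.centralizer {w} = ⊤ := by
    rcases (Nat.dvd_prime hA).1 (Subgroup.index_dvd_of_le hle) with h | h
    · exact Subgroup.index_eq_one.1 h
    · exact absurd h (Subgroup.index_strictAnti hlt).ne
  rw [Subgroup.mem_center_iff]
  intro g
  exact Subgroup.mem_centralizer_singleton_iff.1 (htop ▸ Subgroup.mem_top g)

theorem finrank_le_mul_prank_center {p : ℕ} [Fact p.Prime] {P V : Type*} [Group P] [Finite P]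
    [AddCommGroup V] [Module (ZMod p) V] [FiniteDimensional (ZMod p) V]
    (f : Multiplicative V →* P) (hf : Function.Injective f) (hn : f.range.Normal)
    (hi : f.range.index = p) :
    Module.finrank (ZMod p) V ≤ p * prank p (Subgroup.center P) := by
  have hp : p.Prime := Fact.out
  obtain ⟨x, hx⟩ : ∃ x, x ∉ f.range := by
    by_contra! h
    exact hp.one_lt.ne' (hi ▸ Subgroup.index_eq_one.2 ((Subgroup.eq_top_iff' _).2 h))
  let e := MonoidHom.ofInjective hf
  let ψ : Multiplicative V →* Multiplicative V :=
    e.symm.toMonoidHom.comp ((MulAut.conjNormal x).toMonoidHom.comp e.toMonoidHom)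
  let φ : Module.End (ZMod p) V := (AddMonoidHom.toMultiplicative.symm ψ).toZModLinearMap p
  have hφ (v : V) : f (.ofAdd (φ v)) = x * f (.ofAdd v) * x⁻¹ :=
    congrArg Subtype.val (e.apply_symm_apply (MulAut.conjNormal x (e (.ofAdd v))))
  have hφpow (n : ℕ) (v : V) : f (.ofAdd ((φ ^ n) v)) = x ^ n * f (.ofAdd v) * (x ^ n)⁻¹ := by
    induction n with
    | zero => simp
    | succ n ih =>
      rw [pow_succ', Module.End.mul_apply, hφ, ih, pow_succ']
      group
  have hφp : φ ^ p = 1 := by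
    obtain ⟨a, ha⟩ : x ^ p ∈ f.range := hi ▸ f.range.pow_index_mem x
    ext v
    apply Multiplicative.ofAdd.injective
    apply hf
    rw [hφpow, ← ha, ← map_mul, mul_comm, map_mul, mul_assoc]
    simp
  refine (finrank_le_mul_finrank_ker_sub_one φ hφp).trans (Nat.mul_le_mul_left p ?_)
  let ι : Multiplicative (LinearMap.ker (φ - 1)) →* Multiplicative V :=
    AddMonoidHom.toMultiplicative (LinearMap.ker (φ - 1)).subtype.toAddMonoidHom
  have hι : Function.Injective ι := Subtype.val_injective
  refine finrank_le_prank_center (f.comp ι) (hf.comp hι) fun v => ?_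
  refine Subgroup.mem_center_of_commute_of_index_prime (hi ▸ hp) hx ?_ ?_
  · have hv : φ (v.toAdd : V) = v.toAdd := sub_eq_zero.1 v.toAdd.2
    have := hφ v.toAdd
    rw [hv] at this
    exact (mul_inv_eq_iff_eq_mul.1 this.symm)
  · rintro _ ⟨a, rfl⟩
    exact (Commute.all a (ι v)).map f

theorem Sylow.exists_injective_hom {p : ℕ} [Fact p.Prime] {G E : Type*} [Group G] [Finite G]
    [Group E] (S : Sylow p G) (hE : IsPGroup p E) (f : E →* G) (hf : Function.Injective f) :
    ∃ f' : E →* S, Function.Injective f' := by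
  obtain ⟨Q, hQ⟩ := (hE.of_surjective f.rangeRestrict f.rangeRestrict_surjective).exists_le_sylow
  let i : E →* Q := f.codRestrict (Q : Subgroup G) fun x => hQ ⟨x, rfl⟩
  exact ⟨(Q.equiv S).toMonoidHom.comp i,
    (Q.equiv S).injective.comp ((MonoidHom.injective_codRestrict f _ _).2 hf)⟩

theorem stmt10 {G : Type*} [Group G] [Finite G] (p : ℕ) (hp : p.Prime)
    (S : Sylow p G)
    (hδ : 3 ≤ prank p G - prank p ↥(Subgroup.center ↥(S : Subgroup G))) :
    p ^ 5 ∣ Nat.card G ∧ ((p = 2 ∨ p = 3) → p ^ 6 ∣ Nat.card G) := by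
  have : Fact p.Prime := ⟨hp⟩
  obtain ⟨f₀, hf₀⟩ := exists_injective_hom_prank (p := p) G
  generalize prank p G = r at *
  have hcard : Nat.card (Multiplicative (Fin r → ZMod p)) = p ^ r := by simp
  obtain ⟨f, hf⟩ := S.exists_injective_hom (IsPGroup.of_card hcard) f₀ hf₀
  have hrange : Nat.card f.range = p ^ r := by
    rw [← hcard, Nat.card_congr (MonoidHom.ofInjective hf).toEquiv]
  obtain ⟨n, hn⟩ := IsPGroup.iff_card.1 S.isPGroup'
  have hrn : r ≤ n := by
    rw [← Nat.pow_dvd_pow_iff_le_right hp.one_lt, ← hrange, ← hn]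
    exact f.range.card_subgroup_dvd_card
  have hne : r ≠ n := by
    intro h
    have htop : f.range = ⊤ := Subgroup.eq_top_of_card_eq _ (by rw [hrange, hn, h])
    have hle := finrank_le_prank_center (p := p) f hf fun v => by
      rw [Subgroup.mem_center_iff]
      intro g
      obtain ⟨w, rfl⟩ : g ∈ f.range := htop ▸ Subgroup.mem_top g
      rw [← map_mul, mul_comm, map_mul]
    rw [Module.finrank_fin_fun] at hle
    omega
  have : Nontrivial S := by
    rw [← Finite.one_lt_card_iff_nontrivial, hn]
    exact Nat.one_lt_pow (by omega) hp.one_lt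
  have hz := one_le_prank_center S.isPGroup'
  have hdvd {k : ℕ} (hk : k ≤ n) : p ^ k ∣ Nat.card G :=
    (pow_dvd_pow p hk).trans (hn ▸ (S : Subgroup G).card_subgroup_dvd_card)
  refine ⟨hdvd (by omega), fun hp23 => hdvd ?_⟩
  by_contra hn6
  have hr : r = 4 := by omega
  have hn5 : n = 5 := by omega
  have hi : f.range.index = p := by
    have := f.range.card_mul_index
    rw [hrange, hn, hn5, congrArg (p ^ ·) hr, pow_succ p 4] at this
    exact Nat.eq_of_mul_eq_mul_left (pow_pos hp.pos 4) this
  have hnorm : f.range.Normal := by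
    apply Subgroup.normal_of_index_eq_minFac_card
    rw [hi, hn, hn5, Nat.Prime.pow_minFac hp (by norm_num)]
  have hle := finrank_le_mul_prank_center f hf hnorm hi
  rw [Module.finrank_fin_fun] at hle
  have hz1 : prank p (Subgroup.center S) = 1 := by omega
  rw [hz1] at hle
  omega
end

section
/- Let G be a finite group. If δ₀(G) ≥ 4 for the prime p = 2, then 2^8 divides the order of G. -/
/-- The involutions of the centre of `H`, together with the identity. -/
def centralInvolutions {P : Type*} [Group P] (H : Subgroup P) : Subgroup P where
  carrier := {x | x ∈ H ∧ x * x = 1 ∧ ∀ h ∈ H, h * x = x * h}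
  one_mem' := ⟨H.one_mem, by simp, by simp⟩
  mul_mem' := by
    rintro a b ⟨ha, ha2, hac⟩ ⟨hb, hb2, hbc⟩
    refine ⟨H.mul_mem ha hb, ?_, fun h hh => ?_⟩
    · calc a * b * (a * b) = a * (b * a) * b := by group
        _ = (a * a) * (b * b) := by rw [hac b hb]; group
        _ = 1 := by rw [ha2, hb2, one_mul]
    · rw [← mul_assoc, hac h hh, mul_assoc, hbc h hh, mul_assoc]
  inv_mem' := by
    rintro a ⟨ha, ha2, hac⟩
    rw [inv_eq_of_mul_eq_one_right ha2]
    exact ⟨ha, ha2, hac⟩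

theorem mem_centralInvolutions {P : Type*} [Group P] {H : Subgroup P} {x : P} :
    x ∈ centralInvolutions H ↔ x ∈ H ∧ x * x = 1 ∧ ∀ h ∈ H, h * x = x * h := Iff.rfl

theorem mem_centralInvolutions_of_commute {P : Type*} [Group P] {H K : Subgroup P} (hHK : H ≤ K)
    {t x : P} (hcover : ∀ k ∈ K, k ∈ H ∨ t * k ∈ H) (hx : x ∈ centralInvolutions H)
    (htx : t * x = x * t) : x ∈ centralInvolutions K := by
  obtain ⟨hxH, hx2, hxc⟩ := hx
  refine ⟨hHK hxH, hx2, fun k hk => ?_⟩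
  rcases hcover k hk with h | h
  · exact hxc k h
  · have := hxc _ h
    rw [← mul_assoc, ← htx, mul_assoc, mul_assoc] at this
    exact mul_left_cancel this

theorem card_centralInvolutions_le_sq {P : Type*} [Group P] [Finite P] {H K : Subgroup P}
    (hHK : H ≤ K) (hcard : Nat.card K = 2 * Nat.card H) :
    Nat.card (centralInvolutions H) ≤ Nat.card (centralInvolutions K) ^ 2 := by
  have hindex : (H.subgroupOf K).index = 2 := by
    have h1 := (H.subgroupOf K).card_mul_index
    rw [Nat.card_congr (Subgroup.subgroupOfEquivOfLe hHK).toEquiv, hcard, mul_comm 2] at h1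
    exact Nat.eq_of_mul_eq_mul_left Nat.card_pos h1
  have hnormal : (H.subgroupOf K).Normal := Subgroup.normal_of_index_eq_two hindex
  obtain ⟨⟨t, htK⟩, ht⟩ := Subgroup.index_eq_two_iff_exists_notMem_and.mp hindex
  have htH : t ∉ H := ht.1
  have hcover : ∀ k ∈ K, k ∈ H ∨ t * k ∈ H := fun k hk => by
    by_cases h : k ∈ H
    · exact Or.inl h
    · right
      have := (Subgroup.mul_mem_iff_of_index_two hindex (a := ⟨t, htK⟩) (b := ⟨k, hk⟩))
      simp only [Subgroup.mem_subgroupOf] at this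
      exact this.mpr (by simp [htH, h])
  have htt : t * t ∈ H := (hcover t htK).resolve_left htH
  have hconj : ∀ h ∈ H, t * h * t⁻¹ ∈ H := fun h hh =>
    hnormal.conj_mem ⟨h, hHK hh⟩ hh ⟨t, htK⟩
  have hconj' : ∀ h ∈ H, t⁻¹ * h * t ∈ H := fun h hh => by
    simpa [Subgroup.mem_subgroupOf] using hnormal.conj_mem ⟨h, hHK hh⟩ hh ⟨t, htK⟩⁻¹
  have hconjmem : ∀ w ∈ centralInvolutions H, t * w * t⁻¹ ∈ centralInvolutions H := by
    rintro w ⟨hw, hw2, hwc⟩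
    refine ⟨hconj w hw, ?_, fun h hh => ?_⟩
    · calc t * w * t⁻¹ * (t * w * t⁻¹) = t * (w * w) * t⁻¹ := by group
        _ = 1 := by rw [hw2]; group
    · calc h * (t * w * t⁻¹) = t * ((t⁻¹ * h * t) * w) * t⁻¹ := by group
        _ = t * (w * (t⁻¹ * h * t)) * t⁻¹ := by rw [hwc _ (hconj' h hh)]
        _ = t * w * t⁻¹ * h := by group
  let f : centralInvolutions H →* centralInvolutions H :=
    { toFun := fun w => ⟨w * (t * w * t⁻¹), mul_mem w.2 (hconjmem w w.2)⟩
      map_one' := by ext; simp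
      map_mul' := by
        rintro ⟨a, ha⟩ ⟨b, hb⟩
        ext
        change a * b * (t * (a * b) * t⁻¹) = a * (t * a * t⁻¹) * (b * (t * b * t⁻¹))
        calc a * b * (t * (a * b) * t⁻¹) = a * (b * (t * a * t⁻¹)) * (t * b * t⁻¹) := by group
          _ = a * ((t * a * t⁻¹) * b) * (t * b * t⁻¹) := by
            rw [(hconjmem a ha).2.2 b hb.1]
          _ = _ := by group }
  have hker : Nat.card f.ker ≤ Nat.card (centralInvolutions K) := by
    refine Nat.card_le_card_of_injective
      (fun w => ⟨w.1.1, mem_centralInvolutions_of_commute hHK hcover w.1.2 ?_⟩) ?_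
    · have h1 : w.1.1 * (t * w.1.1 * t⁻¹) = 1 := congrArg Subtype.val (MonoidHom.mem_ker.mp w.2)
      have h2 := mul_left_cancel (h1.trans w.1.2.2.1.symm)
      exact mul_inv_eq_iff_eq_mul.mp h2
    · intro a b hab
      exact Subtype.ext (Subtype.ext (by simpa using hab))
  have hrange : Nat.card f.range ≤ Nat.card (centralInvolutions K) := by
    refine Nat.card_le_card_of_injective
      (fun w => ⟨w.1.1, mem_centralInvolutions_of_commute hHK hcover w.1.2 ?_⟩) ?_
    · obtain ⟨_, ⟨w, hw⟩, rfl⟩ := w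
      change t * (w * (t * w * t⁻¹)) = w * (t * w * t⁻¹) * t
      calc t * (w * (t * w * t⁻¹)) = t * w * t⁻¹ * ((t * t) * w) * t⁻¹ := by group
        _ = t * w * t⁻¹ * (w * (t * t)) * t⁻¹ := by rw [hw.2.2 _ htt]
        _ = (t * w * t⁻¹ * w) * t := by group
        _ = w * (t * w * t⁻¹) * t := by rw [hw.2.2 _ (hconj w hw.1)]
    · intro a b hab
      exact Subtype.ext (Subtype.ext (by simpa using hab))
  calc Nat.card (centralInvolutions H) = Nat.card f.ker * Nat.card f.range := by
        rw [← Subgroup.index_ker, Subgroup.card_mul_index]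
    _ ≤ Nat.card (centralInvolutions K) ^ 2 := by
        rw [sq]; exact Nat.mul_le_mul hker hrange

theorem card_centralInvolutions_le_pow {P : Type*} [Group P] [Finite P] {k m : ℕ}
    (hP : Nat.card P = 2 ^ (m + k)) (H : Subgroup P) (hH : Nat.card H = 2 ^ m) :
    Nat.card (centralInvolutions H) ≤
      Nat.card (centralInvolutions (⊤ : Subgroup P)) ^ (2 ^ k) := by
  induction k generalizing m H with
  | zero =>
    have : H = ⊤ := Subgroup.eq_top_of_card_eq H (by rw [hH, hP, add_zero])
    simp [this]
  | succ k ih =>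
    have : Fact (Nat.Prime 2) := ⟨Nat.prime_two⟩
    obtain ⟨K, hK, hHK⟩ := Sylow.exists_subgroup_card_pow_succ
      (hP ▸ pow_dvd_pow 2 (by omega) : 2 ^ (m + 1) ∣ Nat.card P) hH
    calc Nat.card (centralInvolutions H) ≤ Nat.card (centralInvolutions K) ^ 2 :=
          card_centralInvolutions_le_sq hHK (by rw [hK, hH, pow_succ, mul_comm])
      _ ≤ (Nat.card (centralInvolutions (⊤ : Subgroup P)) ^ (2 ^ k)) ^ 2 :=
          Nat.pow_le_pow_left (ih (by rw [hP]; congr 1; omega) K hK) 2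
      _ = _ := by rw [← pow_mul, ← pow_succ]

theorem bddAbove_elementaryAbelian_ranks (G : Type*) [Group G] [Finite G] :
    BddAbove {r : ℕ | ∃ H : Subgroup G, Nonempty (↥H ≃* Multiplicative (Fin r → ZMod 2))} := by
  refine ⟨Nat.card G, ?_⟩
  rintro r ⟨H, ⟨e⟩⟩
  have h1 : Nat.card H = 2 ^ r := by
    rw [Nat.card_congr (e.toEquiv.trans Multiplicative.toAdd)]
    simp
  exact (Nat.lt_two_pow_self.le.trans h1.ge).trans (Subgroup.card_le_card_group H)

theorem exists_mulEquiv_prank (G : Type*) [Group G] [Finite G] :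
    ∃ H : Subgroup G, Nonempty (↥H ≃* Multiplicative (Fin (prank 2 G) → ZMod 2)) :=
  Nat.sSup_mem (s := {r : ℕ | ∃ H : Subgroup G, Nonempty (↥H ≃* Multiplicative (Fin r → ZMod 2))})
    ⟨0, ⊥, ⟨MulEquiv.ofUnique⟩⟩ (bddAbove_elementaryAbelian_ranks G)

theorem card_le_two_pow_prank {G V : Type*} [Group G] [Finite G] [Group V] (f : V →* G)
    (hf : Function.Injective f) (hV : ∀ x : V, x * x = 1) :
    Nat.card V ≤ 2 ^ prank 2 G := by
  have : Fact (Nat.Prime 2) := ⟨Nat.prime_two⟩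
  have : Finite V := Finite.of_injective f hf
  let : CommGroup V :=
    { mul_comm := fun a b => by
        have h : ∀ x : V, x⁻¹ = x := fun x => inv_eq_of_mul_eq_one_right (hV x)
        rw [← h (a * b), mul_inv_rev, h, h] }
  let : Module (ZMod 2) (Additive V) := AddCommGroup.zmodModule (n := 2) fun x => by
    rw [two_nsmul]; exact hV x.toMul
  let b := Module.finBasis (ZMod 2) (Additive V)
  let e : V ≃* Multiplicative (Fin (Module.finrank (ZMod 2) (Additive V)) → ZMod 2) :=
    (MulEquiv.toAdditiveLeft (G := V)).symm b.equivFun.toAddEquiv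
  have hcard : Nat.card V = 2 ^ Module.finrank (ZMod 2) (Additive V) := by
    rw [Nat.card_congr (e.toEquiv.trans Multiplicative.toAdd)]
    simp
  rw [hcard]
  exact Nat.pow_le_pow_right two_pos (le_csSup (bddAbove_elementaryAbelian_ranks G)
    ⟨f.range, ⟨(MonoidHom.ofInjective hf).symm.trans e⟩⟩)

theorem stmt12 {G : Type*} [Group G] [Finite G]
    (S : Sylow 2 G)
    (hδ : 4 ≤ prank 2 G - prank 2 ↥(Subgroup.center ↥(S : Subgroup G))) :
    2 ^ 8 ∣ Nat.card G := by
  have : Fact (Nat.Prime 2) := ⟨Nat.prime_two⟩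
  obtain ⟨E, ⟨e⟩⟩ := exists_mulEquiv_prank G
  have hE : Nat.card E = 2 ^ prank 2 G := by
    rw [Nat.card_congr (e.toEquiv.trans Multiplicative.toAdd)]
    simp
  have hE2 : ∀ x ∈ E, x * x = 1 := fun x hx => by
    have : (⟨x, hx⟩ * ⟨x, hx⟩ : E) = 1 := by
      apply e.injective
      rw [map_mul, map_one]
      apply Multiplicative.toAdd.injective
      ext i
      exact CharTwo.add_self_eq_zero _
    exact congrArg Subtype.val this
  have hEc : ∀ x ∈ E, ∀ y ∈ E, x * y = y * x := fun x hx y hy => by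
    have : (⟨x, hx⟩ * ⟨y, hy⟩ : E) = ⟨y, hy⟩ * ⟨x, hx⟩ := by
      apply e.injective
      rw [map_mul, map_mul, mul_comm]
    exact congrArg Subtype.val this
  obtain ⟨T, hET⟩ := (IsPGroup.of_card hE).exists_le_sylow
  obtain ⟨n, hn⟩ := IsPGroup.iff_card.mp T.isPGroup'
  have hH : Nat.card (E.subgroupOf T) = 2 ^ prank 2 G := by
    rw [Nat.card_congr (Subgroup.subgroupOfEquivOfLe hET).toEquiv, hE]
  have hle : prank 2 G ≤ n := by
    have hdvd := Subgroup.card_subgroup_dvd_card (E.subgroupOf T)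
    rw [hH, hn] at hdvd
    exact (Nat.pow_dvd_pow_iff_le_right (by norm_num)).mp hdvd
  obtain ⟨k, rfl⟩ := Nat.exists_eq_add_of_le hle
  have hbound := card_centralInvolutions_le_pow hn _ hH
  have htop : centralInvolutions (E.subgroupOf T) = E.subgroupOf T :=
    le_antisymm (fun x hx => hx.1) fun x hx => ⟨hx, Subtype.ext (hE2 x hx), fun y hy =>
      Subtype.ext (hEc y hy x hx)⟩
  rw [htop, hH] at hbound
  let c : Subgroup.center T ≃* Subgroup.center S := Subgroup.centerCongr (T.equiv S)
  have hcenter : Nat.card (centralInvolutions (⊤ : Subgroup T)) ≤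
      2 ^ prank 2 (Subgroup.center S) := by
    refine card_le_two_pow_prank (c.toMonoidHom.comp (Subgroup.inclusion fun x hx =>
      Subgroup.mem_center_iff.mpr fun y => hx.2.2 y trivial)) ?_ fun x => Subtype.ext x.2.2.1
    exact c.injective.comp (Subgroup.inclusion_injective _)
  have hrank := hbound.trans (Nat.pow_le_pow_left hcenter _)
  rw [← pow_mul, Nat.pow_le_pow_iff_right (by norm_num)] at hrank
  refine (pow_dvd_pow 2 ?_).trans (hn ▸ Subgroup.card_subgroup_dvd_card (T : Subgroup G))
  by_contra! hlt
  have hk : k < 4 := by omega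
  interval_cases k <;> omega
end
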